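/- For n ≥ 2, the algebra B(D_n) ⊗_R K obtained by extending scalars from R to its fraction field K = Frac(R) ≅ ℚ(l, δ) is a semisimple ring. (This is the semisimplicity assertion of Theorem 5.3 of the paper.) -/

import Mathlib

noncomputable section

/-! The ring `R = ℤ[δ^{±1}, l^{±1}, m] / ((1−δ)m − l + l⁻¹)`. -/

/-- `ℤ[δ^{±1}, l^{±1}][m] = ℤ[δ^{±1}, l^{±1}, m]`, realised as the monoid algebra
`ℤ[ℤ × ℤ × ℕ]`; the monomial `δ^a l^b m^c` corresponds to `(a, b, c)`. -/
abbrev PreR : Type := AddMonoidAlgebra ℤ (ℤ × ℤ × ℕ)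

/-- The element `δ`. -/
def del : PreR := AddMonoidAlgebra.single ((1 : ℤ), (0 : ℤ), (0 : ℕ)) 1

/-- The element `l`. -/
def ell : PreR := AddMonoidAlgebra.single ((0 : ℤ), (1 : ℤ), (0 : ℕ)) 1

/-- The element `l⁻¹`. -/
def ellInv : PreR := AddMonoidAlgebra.single ((0 : ℤ), (-1 : ℤ), (0 : ℕ)) 1

/-- The element `m`. -/
def mvar : PreR := AddMonoidAlgebra.single ((0 : ℤ), (0 : ℤ), (1 : ℕ)) 1

/-- The principal ideal generated by the defining relation `(1−δ)·m − l + l⁻¹`. -/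
def RIdeal : Ideal PreR := Ideal.span {(1 - del) * mvar - ell + ellInv}

/-- The ring `R = ℤ[δ^{±1}, l^{±1}, m] / ((1−δ)m − l + l⁻¹)`. -/
abbrev RBMW : Type := PreR ⧸ RIdeal

/-- The image of `δ` in `R`. -/
def delR : RBMW := Ideal.Quotient.mk RIdeal del
/-- The image of `l` in `R`. -/
def ellR : RBMW := Ideal.Quotient.mk RIdeal ell
/-- The image of `l⁻¹` in `R`. -/
def ellInvR : RBMW := Ideal.Quotient.mk RIdeal ellInv
/-- The image of `m` in `R`. -/
def mR : RBMW := Ideal.Quotient.mk RIdeal mvar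

/-! The BMW algebra `B(D_n)` of type `D_n`. -/

/-- Adjacency in the Coxeter diagram `D_n`.  Node `k` (`1 ≤ k ≤ n`) is encoded as the
index `k−1 : Fin n`; node `1` is adjacent to node `3`, and node `i` is adjacent to
node `i+1` for `2 ≤ i ≤ n−1`. -/
def dAdj {n : ℕ} (i j : Fin n) : Prop :=
  (i.val = 0 ∧ j.val = 2) ∨ (j.val = 0 ∧ i.val = 2) ∨
  (1 ≤ i.val ∧ j.val = i.val + 1) ∨ (1 ≤ j.val ∧ i.val = j.val + 1)

/-- The free `R`-algebra on the `2n` generators `g_1,…,g_n` (the `Sum.inl i`) and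
`e_1,…,e_n` (the `Sum.inr i`). -/
abbrev FreeBMW (n : ℕ) := FreeAlgebra RBMW (Fin n ⊕ Fin n)

/-- The generator `g_i` of the free algebra. -/
def gF {n : ℕ} (i : Fin n) : FreeBMW n := FreeAlgebra.ι RBMW (Sum.inl i)
/-- The generator `e_i` of the free algebra. -/
def eF {n : ℕ} (i : Fin n) : FreeBMW n := FreeAlgebra.ι RBMW (Sum.inr i)

/-- The defining relations of the BMW algebra `B(D_n)`. -/
inductive BMWRel (n : ℕ) : FreeBMW n → FreeBMW n → Prop
  /- `g_i g_j = g_j g_i` for `i ≁ j` -/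
  | gg {i j : Fin n} : i ≠ j → ¬ dAdj i j → BMWRel n (gF i * gF j) (gF j * gF i)
  /- `e_i g_j = g_j e_i` for `i ≁ j` -/
  | eg {i j : Fin n} : i ≠ j → ¬ dAdj i j → BMWRel n (eF i * gF j) (gF j * eF i)
  /- `e_i e_j = e_j e_i` for `i ≁ j` -/
  | ee {i j : Fin n} : i ≠ j → ¬ dAdj i j → BMWRel n (eF i * eF j) (eF j * eF i)
  /- `g_i g_j g_i = g_j g_i g_j` for `i ∼ j` -/
  | braid {i j : Fin n} : dAdj i j → BMWRel n (gF i * gF j * gF i) (gF j * gF i * gF j)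
  /- `e_i g_j e_i = l e_i` for `i ∼ j` -/
  | ege {i j : Fin n} : dAdj i j → BMWRel n (eF i * gF j * eF i) (ellR • eF i)
  /- `g_j g_i e_j = e_i e_j` for `i ∼ j` -/
  | gge {i j : Fin n} : dAdj i j → BMWRel n (gF j * gF i * eF j) (eF i * eF j)
  /- `e_i g_j g_i = e_i e_j` for `i ∼ j` -/
  | egg {i j : Fin n} : dAdj i j → BMWRel n (eF i * gF j * gF i) (eF i * eF j)
  /- `m e_i = l (g_i² + m g_i − 1)` -/
  | skein {i : Fin n} : BMWRel n (mR • eF i) (ellR • (gF i * gF i + mR • gF i - 1))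
  /- `g_i e_i = l⁻¹ e_i` -/
  | ge {i : Fin n} : BMWRel n (gF i * eF i) (ellInvR • eF i)
  /- `e_i g_i = l⁻¹ e_i` -/
  | eg' {i : Fin n} : BMWRel n (eF i * gF i) (ellInvR • eF i)
  /- `e_i² = δ e_i` -/
  | esq {i : Fin n} : BMWRel n (eF i * eF i) (delR • eF i)

/-- The BMW algebra `B(D_n)`: the quotient of the free `R`-algebra on the `2n`
generators by the two-sided ideal generated by the defining relations. -/
abbrev BMW (n : ℕ) := RingQuot (BMWRel n)

/-- The generator `g_i` of `B(D_n)`. -/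
def gB {n : ℕ} (i : Fin n) : BMW n := RingQuot.mkAlgHom RBMW (BMWRel n) (gF i)
/-- The generator `e_i` of `B(D_n)`. -/
def eB {n : ℕ} (i : Fin n) : BMW n := RingQuot.mkAlgHom RBMW (BMWRel n) (eF i)

namespace BMWProof

/-- Relations for an adjacent pair of nodes. -/
structure Pair {V Λ : Type*} [CommRing V] [Ring Λ] [Algebra V Λ]
    (t l li m μ : V) (a e b f : Λ) : Prop where
  aba : a * b * a = b * a * b
  abe : a * b * e = f * a * b
  baf : b * a * f = e * b * a
  ebe : e * b * e = (t * l) • e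
  faf : f * a * f = (t * l) • f
  ef : e * f = t • (b * a * f)
  fe : f * e = t • (a * b * e)
  aa : a * a = 1 - m • a + (μ * li) • e
  ae : a * e = li • e
  ea : e * a = li • e
  ee : e * e = e
  bb : b * b = 1 - m • b + (μ * li) • f
  bf : b * f = li • f
  fb : f * b = li • f
  ff : f * f = f

/-- The span of `1, a, e`. -/
def Asp (V : Type*) {Λ : Type*} [CommRing V] [Ring Λ] [Algebra V Λ] (a e : Λ) :
    Submodule V Λ := Submodule.span V {1, a, e}

section
variable {V Λ : Type*} [CommRing V] [Ring Λ] [Algebra V Λ]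
  {t l li m μ : V} {a e b f : Λ}

theorem Pair.symm (h : Pair t l li m μ a e b f) : Pair t l li m μ b f a e :=
  ⟨h.aba.symm, h.baf, h.abe, h.faf, h.ebe, h.fe, h.ef, h.bb, h.bf, h.fb, h.ff,
    h.aa, h.ae, h.ea, h.ee⟩

theorem one_mem_Asp : (1 : Λ) ∈ Asp V a e := Submodule.subset_span (by simp)
theorem a_mem_Asp : a ∈ Asp V a e := Submodule.subset_span (by simp)
theorem e_mem_Asp : e ∈ Asp V a e := Submodule.subset_span (by simp)

/-- The inverse of `a`. -/
def inv' (m μ : V) (a e : Λ) : Λ := a + m • 1 - μ • e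

theorem inv'_mem : inv' m μ a e ∈ Asp V a e :=
  sub_mem (add_mem a_mem_Asp (Submodule.smul_mem _ _ one_mem_Asp))
    (Submodule.smul_mem _ _ e_mem_Asp)

theorem mul_inv' (aa : a * a = 1 - m • a + (μ * li) • e) (ae : a * e = li • e) :
    a * inv' m μ a e = 1 := by
  simp only [inv', mul_sub, mul_add, mul_smul_comm, mul_one, aa, ae]
  module

theorem inv'_mul (aa : a * a = 1 - m • a + (μ * li) • e) (ea : e * a = li • e) :
    inv' m μ a e * a = 1 := by
  simp only [inv', sub_mul, add_mul, smul_mul_assoc, one_mul, aa, ea]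
  module

theorem Asp_induction {P : Λ → Prop} (T : Submodule V Λ) (φ : Λ →ₗ[V] Λ)
    (hP : ∀ x, P x ↔ φ x ∈ T)
    (h1 : P 1) (ha : P a) (he : P e) : ∀ x ∈ Asp V a e, P x := by
  intro x hx
  rw [hP] at *
  change x ∈ T.comap φ
  refine (Submodule.span_le.2 ?_ : Asp V a e ≤ T.comap φ) hx
  rintro y (rfl | rfl | rfl) <;> assumption

/-- Middle variable induction: `x * p * y ∈ T` for all `p` in the span. -/
theorem Asp_mid (T : Submodule V Λ) (x y : Λ)
    (h1 : x * y ∈ T) (ha : x * a * y ∈ T) (he : x * e * y ∈ T) :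
    ∀ p ∈ Asp V a e, x * p * y ∈ T :=
  Asp_induction T ((LinearMap.mulRight V y).comp (LinearMap.mulLeft V x))
    (fun p => by simp) (by simpa using h1) ha he

theorem Asp_left (T : Submodule V Λ) (y : Λ)
    (h1 : y ∈ T) (ha : a * y ∈ T) (he : e * y ∈ T) :
    ∀ p ∈ Asp V a e, p * y ∈ T :=
  Asp_induction T (LinearMap.mulRight V y)
    (fun p => by simp) (by simpa using h1) ha he

theorem Asp_right (T : Submodule V Λ) (x : Λ)
    (h1 : x ∈ T) (ha : x * a ∈ T) (he : x * e ∈ T) :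
    ∀ p ∈ Asp V a e, x * p ∈ T :=
  Asp_induction T (LinearMap.mulLeft V x)
    (fun p => by simp) (by simpa using h1) ha he

theorem Asp_mul_self (aa : a * a = 1 - m • a + (μ * li) • e) (ae : a * e = li • e)
    (ea : e * a = li • e) (ee : e * e = e) : Asp V a e * Asp V a e ≤ Asp V a e := by
  rw [Submodule.mul_le]
  intro p hp q hq
  revert p
  refine Asp_left _ _ hq ?_ ?_ <;> revert q
  · refine Asp_right _ _ a_mem_Asp ?_ ?_
    · rw [aa]
      exact add_mem (sub_mem one_mem_Asp (Submodule.smul_mem _ _ a_mem_Asp))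
        (Submodule.smul_mem _ _ e_mem_Asp)
    · rw [ae]; exact (Submodule.smul_mem _ _ e_mem_Asp)
  · refine Asp_right _ _ e_mem_Asp ?_ ?_
    · rw [ea]; exact (Submodule.smul_mem _ _ e_mem_Asp)
    · rw [ee]; exact e_mem_Asp

theorem Pair.af (h : Pair t l li m μ a e b f) : a * f = inv' m μ b f * (e * b * a) := by
  rw [← h.baf, mul_assoc b, ← mul_assoc, inv'_mul h.bb h.fb, one_mul]

theorem Pair.fa (h : Pair t l li m μ a e b f) : f * a = a * b * e * inv' m μ b f := by
  rw [h.abe, mul_assoc _ b, mul_inv' h.bb h.bf, mul_one]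

theorem Pair.ef' (h : Pair t l li m μ a e b f) : e * f = t • (e * b * a) := by
  rw [h.ef, h.baf]

theorem Pair.aca' (h : Pair t l li m μ a e b f) (T : Submodule V Λ)
    (key : ∀ x ∈ Asp V b f, ∀ y ∈ Asp V a e, ∀ z ∈ Asp V b f, x * y * z ∈ T) :
    ∀ p ∈ Asp V a e, ∀ c ∈ Asp V b f, ∀ q ∈ Asp V a e, p * c * q ∈ T := by
  have o1 : (1 : Λ) ∈ Asp V a e := one_mem_Asp
  have o2 : (1 : Λ) ∈ Asp V b f := one_mem_Asp
  have ma : a ∈ Asp V a e := a_mem_Asp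
  have me : e ∈ Asp V a e := e_mem_Asp
  have mb : b ∈ Asp V b f := a_mem_Asp
  have mf : f ∈ Asp V b f := e_mem_Asp
  have mbi : inv' m μ b f ∈ Asp V b f := inv'_mem
  have ce : ∀ x ∈ Asp V b f, x * e ∈ T := fun x hx => by
    simpa using key x hx e me 1 o2
  have e1 : e ∈ T := by simpa using ce 1 o2
  have ecb : ∀ x ∈ Asp V b f, x * e * b ∈ T :=
    fun x hx => key x hx e me b mb
  have heba : e * b * a ∈ T := by
    rw [← h.baf]; exact key _ mb _ ma _ mf
  have hebe : e * b * e ∈ T := by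
    rw [h.ebe]; exact Submodule.smul_mem _ _ e1
  have hebaa : e * b * a * a ∈ T := by
    have : e * b * a * a = e * b - m • (e * b * a) + (μ * li) • (e * b * e) := by
      rw [mul_assoc _ a a, h.aa]; simp [mul_add, mul_sub]
    rw [this]
    refine add_mem (sub_mem ?_ (Submodule.smul_mem _ _ heba)) (Submodule.smul_mem _ _ hebe)
    simpa using ecb 1 o2
  have habe : a * b * e ∈ T := by
    rw [h.abe]; exact key _ mf _ ma _ mb
  intro p hp c hc q hq
  revert c
  have P1 : p * q ∈ T := by
    have := key 1 o2 _ (Asp_mul_self h.aa h.ae h.ea h.ee (Submodule.mul_mem_mul hp hq)) 1 o2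
    simpa using this
  refine Asp_mid _ _ _ P1 ?_ ?_
  · revert q
    suffices ∀ q ∈ Asp V a e, p * b * q ∈ T from
      fun q hq _ => this q hq
    refine Asp_right _ _ ?_ ?_ ?_
    · simpa using key 1 o2 p hp b mb
    · rw [mul_assoc]
      suffices ∀ p ∈ Asp V a e, p * (b * a) ∈ T from this p hp
      refine Asp_left _ _ ?_ ?_ ?_
      · simpa using key b mb a ma 1 o2
      · rw [← mul_assoc, h.aba]; exact key _ mb _ ma _ mb
      · rw [← mul_assoc]; exact heba
    · rw [mul_assoc]
      suffices ∀ p ∈ Asp V a e, p * (b * e) ∈ T from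
        this p hp
      refine Asp_left _ _ ?_ ?_ ?_
      · simpa using key b mb e me 1 o2
      · rw [← mul_assoc]; exact habe
      · rw [← mul_assoc]; exact hebe
  · suffices ∀ q ∈ Asp V a e, p * f * q ∈ T from this q hq
    refine Asp_right _ _ ?_ ?_ ?_
    · simpa using key 1 o2 p hp f mf
    · rw [mul_assoc]
      suffices ∀ p ∈ Asp V a e, p * (f * a) ∈ T from
        this p hp
      refine Asp_left _ _ ?_ ?_ ?_
      · simpa using key f mf a ma 1 o2
      · have : a * (f * a) = inv' m μ b f * e * b - m • (a * f)
            + (μ * li * t * l) • (inv' m μ b f * e) := by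
          have : a * (f * a) = inv' m μ b f * (e * b) * (a * a) := by
            rw [← mul_assoc, h.af]; simp only [mul_assoc]
          rw [this, h.aa, h.af]
          simp only [mul_add, mul_sub, mul_smul_comm, mul_one, mul_assoc]
          rw [← mul_assoc e b e, h.ebe]
          simp only [mul_smul_comm, smul_smul, mul_assoc]
        rw [this]
        refine add_mem (sub_mem (ecb _ mbi) (Submodule.smul_mem _ _ ?_))
          (Submodule.smul_mem _ _ (ce _ mbi))
        simpa using key 1 o2 _ ma _ mf
      · rw [← mul_assoc, h.ef', smul_mul_assoc]
        exact Submodule.smul_mem _ _ hebaa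
    · rw [mul_assoc, h.fe, mul_smul_comm]
      refine Submodule.smul_mem _ _ ?_
      suffices ∀ p ∈ Asp V a e, p * (a * b * e) ∈ T from
        this p hp
      refine Asp_left _ _ habe ?_ ?_
      · have : a * (a * b * e) = b * e - m • (a * b * e) + (μ * li) • (e * b * e) := by
          rw [← mul_assoc, ← mul_assoc, h.aa]; simp [add_mul, sub_mul]
        rw [this]
        exact add_mem (sub_mem (ce _ mb) (Submodule.smul_mem _ _ habe))
          (Submodule.smul_mem _ _ hebe)
      · have : e * (a * b * e) = li • (e * b * e) := by
          rw [← mul_assoc, ← mul_assoc, h.ea]; simp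
        rw [this]
        exact Submodule.smul_mem _ _ hebe

theorem Pair.aca (h : Pair t l li m μ a e b f) :
    ∀ p ∈ Asp V a e, ∀ c ∈ Asp V b f, ∀ q ∈ Asp V a e,
      p * c * q ∈ Asp V b f * Asp V a e * Asp V b f :=
  h.aca' _ fun _ hx _ hy _ hz => Submodule.mul_mem_mul (Submodule.mul_mem_mul hx hy) hz

theorem Pair.aca_le (h : Pair t l li m μ a e b f) :
    Asp V a e * Asp V b f * Asp V a e ≤ Asp V b f * Asp V a e * Asp V b f := by
  refine Submodule.mul_le.2 fun x hx q hq => ?_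
  refine Submodule.mul_induction_on hx (fun p hp c hc => h.aca p hp c hc q hq) ?_
  intro x y hx hy
  rw [add_mul]; exact add_mem hx hy

end
end BMWProof

namespace BMWProof
section
variable {V Λ : Type*} [CommRing V] [Ring Λ] [Algebra V Λ]
  {t l li m μ : V} {a e b f : Λ}

theorem Asp_commute {H : Λ} (ha : Commute H a) (he : Commute H e) :
    ∀ p ∈ Asp V a e, H * p = p * H := by
  intro p hp
  have : ∀ p ∈ Asp V a e, (H * p - p * H) ∈ (⊥ : Submodule V Λ) := by
    refine Asp_induction ⊥ (LinearMap.mulLeft V H - LinearMap.mulRight V H) (fun x => by simp)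
      ?_ ?_ ?_
    · simp
    · simp [ha.eq]
    · simp [he.eq]
  simpa [sub_eq_zero] using this p hp

/-- The core computation: `e G a G` where `G = b H b`. -/
theorem eGaG (h : Pair t l li m μ a e b f) {H z : Λ} (hHa : Commute H a) (hHe : Commute H e)
    (hz : f * H * b * H = z * f) :
    e * (b * H * b) * a * (b * H * b) = b * a * z * a * b * e := by
  calc e * (b * H * b) * a * (b * H * b) = e * b * H * (b * a * b) * H * b := by
        simp only [mul_assoc]
    _ = e * b * (H * a) * b * (a * H * b) := by rw [← h.aba]; simp only [mul_assoc]
    _ = (e * b * a) * H * b * (a * H) * b := by rw [hHa.eq]; simp only [mul_assoc]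
    _ = (e * b * a) * H * b * H * a * b := by rw [← hHa.eq]; simp only [mul_assoc]
    _ = b * a * (f * H * b * H) * a * b := by rw [← h.baf]; simp only [mul_assoc]
    _ = b * a * z * (f * a * b) := by rw [hz]; simp only [mul_assoc]
    _ = _ := by rw [← h.abe]; simp only [mul_assoc]

theorem ebaHbe (h : Pair t l li m μ a e b f) {H Hi z : Λ} (hHa : Commute H a) (hHe : Commute H e)
    (hHi : H * Hi = 1) (hz : f * H * b * H = z * f) :
    e * b * a * H * b * e = t • (e * (b * H * b) * a * (b * H * b * Hi)) := by
  have h1 : e * b * a * H * b * e * H = t • (e * (b * H * b) * a * (b * H * b)) := by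
    calc e * b * a * H * b * e * H = (e * b * a) * H * b * (e * H) := by simp only [mul_assoc]
      _ = b * a * (f * H * b * H) * e := by rw [← h.baf, ← hHe.eq]; simp only [mul_assoc]
      _ = b * a * z * (f * e) := by rw [hz]; simp only [mul_assoc]
      _ = _ := by rw [h.fe, eGaG h hHa hHe hz, mul_smul_comm]; simp only [mul_assoc]
  have h2 := congrArg (· * Hi) h1
  simp only [mul_assoc, hHi, mul_one, smul_mul_assoc] at h2 ⊢
  exact h2

theorem achca (h : Pair t l li m μ a e b f) {H Hi z : Λ} (hHa : Commute H a) (hHe : Commute H e)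
    (hHi : H * Hi = 1) (hz : f * H * b * H = z * f) (B S : Submodule V Λ)
    (BB : ∀ x ∈ B, ∀ y ∈ B, x * y ∈ B) (B1 : 1 ∈ B) (CB : Asp V b f ≤ B) (HB : H ∈ B) (HiB : Hi ∈ B)
    (S1 : ∀ x ∈ B, ∀ p ∈ Asp V a e, ∀ y ∈ B, x * p * y ∈ S)
    (S2 : ∀ p ∈ Asp V a e, ∀ q ∈ Asp V a e, p * (b * H * b) * q ∈ S)
    (BS : ∀ x ∈ B, ∀ s ∈ S, x * s ∈ S) (SB : ∀ s ∈ S, ∀ x ∈ B, s * x ∈ S) :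
    ∀ p ∈ Asp V a e, ∀ c ∈ Asp V b f, ∀ c' ∈ Asp V b f, ∀ q ∈ Asp V a e,
      p * c * H * c' * q ∈ S := by
  have ma : a ∈ Asp V a e := a_mem_Asp
  have me : e ∈ Asp V a e := e_mem_Asp
  have m1 : (1 : Λ) ∈ Asp V a e := one_mem_Asp
  have mb : b ∈ B := CB a_mem_Asp
  have mf : f ∈ B := CB e_mem_Asp
  have mbi : inv' m μ b f ∈ B := CB inv'_mem
  have S1l : ∀ x ∈ B, ∀ p ∈ Asp V a e, x * p ∈ S := fun x hx p hp => by
    simpa using S1 x hx p hp 1 B1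
  have S1r : ∀ p ∈ Asp V a e, ∀ x ∈ B, p * x ∈ S := fun p hp x hx => by
    simpa using S1 1 B1 p hp x hx
  have ACA : ∀ p ∈ Asp V a e, ∀ c ∈ Asp V b f, ∀ q ∈ Asp V a e, p * c * q ∈ S :=
    h.aca' S fun x hx y hy z hz => S1 x (CB hx) y hy z (CB hz)
  have HA := Asp_commute (V := V) hHa hHe
  have hΦ : e * b * a * H * b * e ∈ S := by
    rw [ebaHbe h hHa hHe hHi hz]
    exact Submodule.smul_mem _ _ (SB _ (S2 _ me _ ma) _ (BB _ (BB _ (BB _ mb _ HB) _ mb) _ HiB))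
  have L1 : ∀ p ∈ Asp V a e, p * (f * H * b * e) ∈ S := by
    refine Asp_left _ _ ?_ ?_ ?_
    · exact S1l _ (BB _ (BB _ mf _ HB) _ mb) _ me
    · have : a * (f * H * b * e) = inv' m μ b f * (e * b * a * H * b * e) := by
        simp only [← mul_assoc, h.af]
      rw [this]; exact BS _ mbi _ hΦ
    · have : e * (f * H * b * e) = t • (e * b * a * H * b * e) := by
        simp only [← mul_assoc, h.ef', smul_mul_assoc]
      rw [this]; exact Submodule.smul_mem _ _ hΦ
  have L2 : ∀ p ∈ Asp V a e, ∀ c ∈ Asp V b f, p * c * (H * b * e) ∈ S := by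
    intro p hp
    refine Asp_mid _ _ _ ?_ ?_ ?_
    · have : p * (H * b * e) = H * (p * b * e) := by
        simp only [← mul_assoc, HA p hp]
      rw [this]; exact BS _ HB _ (ACA _ hp _ a_mem_Asp _ me)
    · simpa only [mul_assoc] using S2 _ hp _ me
    · simpa only [mul_assoc] using L1 _ hp
  have L2' : ∀ p ∈ Asp V a e, ∀ c ∈ Asp V b f, ∀ q ∈ Asp V a e,
      p * c * q * (H * b * e) ∈ S := by
    have := h.aca' (S.comap (LinearMap.mulRight V (H * b * e))) ?_
    · intro p hp c hc q hq
      simpa [mul_assoc] using this p hp c hc q hq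
    · intro x hx y hy z hz
      have := BS _ (CB hx) _ (L2 y hy z hz)
      simpa [mul_assoc] using this
  have hX : e * b * a * H * b * a ∈ S := by
    have : e * b * a * H * b * a = e * (b * H * b) * a * b := by
      calc e * b * a * H * b * a = e * b * (a * H) * b * a := by simp only [mul_assoc]
        _ = e * b * H * (a * b * a) := by rw [← hHa.eq]; simp only [mul_assoc]
        _ = _ := by rw [h.aba]; simp only [mul_assoc]
    rw [this]; exact SB _ (S2 _ me _ ma) _ mb
  intro p hp c hc c' hc' q hq
  revert c'
  refine Asp_mid _ _ _ ?_ ?_ ?_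
  · have : p * c * H * q = p * c * q * H := by
      rw [mul_assoc, HA q hq, ← mul_assoc]
    rw [this]; exact SB _ (ACA _ hp _ hc _ hq) _ HB
  · revert q
    refine Asp_right _ _ ?_ ?_ ?_
    · simpa only [mul_assoc] using S1r p hp _ (BB _ (BB _ (CB hc) _ HB) _ mb)
    · have : ∀ c ∈ Asp V b f, p * c * (H * b * a) ∈ S := by
        refine Asp_mid _ _ _ ?_ ?_ ?_
        · have : p * (H * b * a) = H * (p * b * a) := by
            simp only [← mul_assoc, HA p hp]
          rw [this]; exact BS _ HB _ (ACA _ hp _ a_mem_Asp _ ma)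
        · simpa only [mul_assoc] using S2 _ hp _ ma
        · rw [mul_assoc]
          revert p
          suffices ∀ p ∈ Asp V a e, p * (f * (H * b * a)) ∈ S from fun p hp => this p hp
          refine Asp_left _ _ ?_ ?_ ?_
          · simpa only [mul_assoc] using S1l _ (BB _ (BB _ mf _ HB) _ mb) _ ma
          · have : a * (f * (H * b * a)) = inv' m μ b f * (e * b * a * H * b * a) := by
              simp only [← mul_assoc, h.af]
            rw [this]; exact BS _ mbi _ hX
          · have : e * (f * (H * b * a)) = t • (e * b * a * H * b * a) := by
              simp only [← mul_assoc, h.ef', smul_mul_assoc]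
            rw [this]; exact Submodule.smul_mem _ _ hX
      simpa only [mul_assoc] using this c hc
    · simpa only [mul_assoc] using L2 p hp c hc
  · revert q
    refine Asp_right _ _ ?_ ?_ ?_
    · simpa only [mul_assoc] using S1r p hp _ (BB _ (BB _ (CB hc) _ HB) _ mf)
    · have : p * c * H * f * a = p * c * a * (H * b * e) * inv' m μ b f := by
        calc p * c * H * f * a = p * c * H * (f * a) := by simp only [mul_assoc]
          _ = p * c * (H * a) * b * e * inv' m μ b f := by rw [h.fa]; simp only [mul_assoc]
          _ = _ := by rw [hHa.eq]; simp only [mul_assoc]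
      rw [this]; exact SB _ (L2' _ hp _ hc _ ma) _ mbi
    · have : p * c * H * f * e = t • (p * c * a * (H * b * e)) := by
        calc p * c * H * f * e = p * c * H * (f * e) := by simp only [mul_assoc]
          _ = t • (p * c * (H * a) * b * e) := by
            rw [h.fe, mul_smul_comm]; simp only [mul_assoc]
          _ = _ := by rw [hHa.eq]; simp only [mul_assoc]
      rw [this]; exact Submodule.smul_mem _ _ (L2' _ hp _ hc _ ma)

end
end BMWProof

namespace BMWProof
section
variable {V Λ : Type*} [CommRing V] [Ring Λ] [Algebra V Λ]
  {t l li m μ : V} {a e b f c d : Λ}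

theorem eGaG_base (h : Pair t l li m μ a e b f) (h' : Pair t l li m μ a e c d)
    (fc : Commute f c) (bc : Commute b c) :
    e * (b * c) * a * (b * c) = b * a * c * a * b * e := by
  calc e * (b * c) * a * (b * c) = e * b * c * a * (b * c) := by simp only [mul_assoc]
    _ = e * b * (c * a * c) * b := by rw [bc.eq]; simp only [mul_assoc]
    _ = (e * b * a) * c * a * b := by rw [← h'.aba]; simp only [mul_assoc]
    _ = b * a * (f * c) * a * b := by rw [← h.baf]; simp only [mul_assoc]
    _ = b * a * c * (f * a * b) := by rw [fc.eq]; simp only [mul_assoc]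
    _ = _ := by rw [← h.abe]; simp only [mul_assoc]

theorem base_X (h : Pair t l li m μ a e b f) (h' : Pair t l li m μ a e c d)
    (fc : Commute f c) (bc : Commute b c) :
    e * b * a * c * e = t • (e * (b * c) * a * (b * c)) := by
  rw [eGaG_base h h' fc bc]
  calc e * b * a * c * e = b * a * (f * c) * e := by rw [← h.baf]; simp only [mul_assoc]
    _ = b * a * c * (f * e) := by rw [fc.eq]; simp only [mul_assoc]
    _ = _ := by rw [h.fe, mul_smul_comm]; simp only [mul_assoc]

theorem base_fb (h : Pair t l li m μ a e b f) (h' : Pair t l li m μ a e c d)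
    (fc : Commute f c) (bc : Commute b c)
    (B S : Submodule V Λ)
    (BB : ∀ x ∈ B, ∀ y ∈ B, x * y ∈ B) (B1 : 1 ∈ B) (CB : Asp V b f ≤ B) (DB : Asp V c d ≤ B)
    (S1 : ∀ x ∈ B, ∀ p ∈ Asp V a e, ∀ y ∈ B, x * p * y ∈ S)
    (S2 : ∀ p ∈ Asp V a e, ∀ q ∈ Asp V a e, p * (b * c) * q ∈ S)
    (BS : ∀ x ∈ B, ∀ s ∈ S, x * s ∈ S) (SB : ∀ s ∈ S, ∀ x ∈ B, s * x ∈ S) :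
    ∀ p ∈ Asp V a e, ∀ q ∈ Asp V a e, p * (f * c) * q ∈ S := by
  have ma : a ∈ Asp V a e := a_mem_Asp
  have me : e ∈ Asp V a e := e_mem_Asp
  have mb : b ∈ B := CB a_mem_Asp
  have mc : c ∈ B := DB a_mem_Asp
  have mf : f ∈ B := CB e_mem_Asp
  have X : ∀ q ∈ Asp V a e, e * b * a * c * q ∈ S := by
    refine Asp_right _ _ ?_ ?_ ?_
    · rw [← h.baf]
      simpa only [mul_assoc] using S1 b mb a ma _ (BB _ mf _ mc)
    · have : e * b * a * c * a = e * (b * c) * a * c := by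
        calc e * b * a * c * a = e * b * (a * c * a) := by simp only [mul_assoc]
          _ = _ := by rw [h'.aba]; simp only [mul_assoc]
      rw [this]
      exact SB _ (S2 _ me _ ma) _ mc
    · rw [base_X h h' fc bc]
      exact Submodule.smul_mem _ _ (SB _ (S2 _ me _ ma) _ (BB _ mb _ mc))
  intro p hp q hq
  rw [mul_assoc]
  suffices ∀ p ∈ Asp V a e, p * (f * c * q) ∈ S from this p hp
  refine Asp_left _ _ ?_ ?_ ?_
  · simpa only [mul_one] using S1 _ (BB _ mf _ mc) q hq 1 B1
  · have : a * (f * c * q) = inv' m μ b f * (e * b * a * c * q) := by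
      simp only [← mul_assoc, h.af]
    rw [this]; exact BS _ (CB inv'_mem) _ (X q hq)
  · have : e * (f * c * q) = t • (e * b * a * c * q) := by
      simp only [← mul_assoc, h.ef', smul_mul_assoc]
    rw [this]; exact Submodule.smul_mem _ _ (X q hq)

theorem base_ABA (h : Pair t l li m μ a e b f) (h' : Pair t l li m μ a e c d)
    (fc : Commute f c) (bd : Commute b d) (bc : Commute b c)
    (B S : Submodule V Λ)
    (BB : ∀ x ∈ B, ∀ y ∈ B, x * y ∈ B) (B1 : 1 ∈ B) (CB : Asp V b f ≤ B) (DB : Asp V c d ≤ B)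
    (S1 : ∀ x ∈ B, ∀ p ∈ Asp V a e, ∀ y ∈ B, x * p * y ∈ S)
    (S2 : ∀ p ∈ Asp V a e, ∀ q ∈ Asp V a e, p * (b * c) * q ∈ S)
    (BS : ∀ x ∈ B, ∀ s ∈ S, x * s ∈ S) (SB : ∀ s ∈ S, ∀ x ∈ B, s * x ∈ S) :
    ∀ p ∈ Asp V a e, ∀ x ∈ Asp V b f, ∀ y ∈ Asp V c d, ∀ q ∈ Asp V a e, p * (x * y) * q ∈ S := by
  have ma : a ∈ Asp V a e := a_mem_Asp
  have me : e ∈ Asp V a e := e_mem_Asp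
  have mb : b ∈ B := CB a_mem_Asp
  have mc : c ∈ B := DB a_mem_Asp
  have mf : f ∈ B := CB e_mem_Asp
  have md : d ∈ B := DB e_mem_Asp
  have fb := base_fb h h' fc bc B S BB B1 CB DB S1 S2 BS SB
  have bd' := base_fb h' h bd.symm bc.symm B S BB B1 DB CB S1
    (fun p hp q hq => by rw [← bc.eq]; exact S2 p hp q hq) BS SB
  have ACA : ∀ p ∈ Asp V a e, ∀ c ∈ Asp V b f, ∀ q ∈ Asp V a e, p * c * q ∈ S :=
    h.aca' S fun x hx y hy z hz => S1 x (CB hx) y hy z (CB hz)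
  have ADA : ∀ p ∈ Asp V a e, ∀ y ∈ Asp V c d, ∀ q ∈ Asp V a e, p * y * q ∈ S :=
    h'.aca' S fun x hx y hy z hz => S1 x (DB hx) y hy z (DB hz)
  have X : e * b * a * c * e ∈ S := by
    rw [base_X h h' fc bc]
    exact Submodule.smul_mem _ _ (SB _ (S2 _ me _ ma) _ (BB _ mb _ mc))
  have Y : e * b * a * (a * c * e) ∈ S := by
    have : e * b * a * (a * c * e) = e * (b * c) * e - m • (e * b * a * c * e)
        + (μ * li) • ((t * l) • ((t * l) • e)) := by
      calc e * b * a * (a * c * e) = e * b * (a * a) * c * e := by simp only [mul_assoc]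
        _ = e * (b * c) * e - m • (e * b * a * c * e) + (μ * li) • (e * b * (e * c * e)) := by
          rw [h.aa]; simp [mul_add, add_mul, mul_sub, sub_mul, mul_assoc]
        _ = _ := by rw [h'.ebe, mul_smul_comm, h.ebe]
    rw [this]
    refine add_mem (sub_mem (S2 _ me _ me) (Submodule.smul_mem _ _ X))
      (Submodule.smul_mem _ _ (Submodule.smul_mem _ _ (Submodule.smul_mem _ _ ?_)))
    simpa using S1 1 B1 e me 1 B1
  have Z : ∀ q ∈ Asp V a e, e * b * a * d * q ∈ S := by
    refine Asp_right _ _ ?_ ?_ ?_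
    · rw [← h.baf]
      simpa only [mul_assoc] using S1 b mb a ma _ (BB _ mf _ md)
    · have : e * b * a * d * a = e * b * a * (a * c * e) * inv' m μ c d := by
        rw [mul_assoc, h'.fa]; simp only [mul_assoc]
      rw [this]; exact SB _ Y _ (DB inv'_mem)
    · rw [mul_assoc, h'.fe, mul_smul_comm]
      exact Submodule.smul_mem _ _ Y
  intro p hp x hx y hy q hq
  revert x
  have : ∀ x ∈ Asp V b f, p * x * (y * q) ∈ S := by
    refine Asp_mid _ _ _ ?_ ?_ ?_
    · simpa only [mul_assoc] using ADA p hp y hy q hq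
    · revert y
      have : ∀ y ∈ Asp V c d, p * b * y * q ∈ S := by
        refine Asp_mid _ _ _ (ACA _ hp _ a_mem_Asp _ hq) ?_ ?_
        · simpa only [mul_assoc] using S2 p hp q hq
        · rw [mul_assoc p, bd.eq]; exact bd' p hp q hq
      simpa only [mul_assoc] using this
    · revert y
      have : ∀ y ∈ Asp V c d, p * f * y * q ∈ S := by
        refine Asp_mid _ _ _ (ACA _ hp _ e_mem_Asp _ hq) ?_ ?_
        · simpa only [mul_assoc] using fb p hp q hq
        · suffices ∀ p ∈ Asp V a e, p * (f * d * q) ∈ S by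
            simpa only [mul_assoc] using this p hp
          refine Asp_left _ _ ?_ ?_ ?_
          · simpa only [mul_one] using S1 _ (BB _ mf _ md) q hq 1 B1
          · have : a * (f * d * q) = inv' m μ b f * (e * b * a * d * q) := by
              simp only [← mul_assoc, h.af]
            rw [this]; exact BS _ (CB inv'_mem) _ (Z q hq)
          · have : e * (f * d * q) = t • (e * b * a * d * q) := by
              simp only [← mul_assoc, h.ef', smul_mul_assoc]
            rw [this]; exact Submodule.smul_mem _ _ (Z q hq)
      simpa only [mul_assoc] using this
  simpa only [mul_assoc] using this

end
end BMWProof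

namespace BMWProof
section
variable {V Λ : Type*} [CommRing V] [Ring Λ] [Algebra V Λ]

/-- Next subspace. -/
def nextS (B A G : Submodule V Λ) : Submodule V Λ := B * A * B ⊔ B * A * G * A * B

variable {B A G : Submodule V Λ}

theorem le_nextS1 : B * A * B ≤ nextS B A G := le_sup_left
theorem le_nextS2 : B * A * G * A * B ≤ nextS B A G := le_sup_right

theorem B_nextS (BB : B * B ≤ B) : B * nextS B A G ≤ nextS B A G := by
  rw [nextS, Submodule.mul_sup]
  refine sup_le_sup ?_ ?_
  · calc B * (B * A * B) = (B * B) * A * B := by simp only [mul_assoc]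
      _ ≤ _ := by gcongr
  · calc B * (B * A * G * A * B) = (B * B) * A * G * A * B := by simp only [mul_assoc]
      _ ≤ _ := by gcongr

theorem nextS_B (BB : B * B ≤ B) : nextS B A G * B ≤ nextS B A G := by
  rw [nextS, Submodule.sup_mul]
  refine sup_le_sup ?_ ?_
  · calc (B * A * B) * B = B * A * (B * B) := by simp only [mul_assoc]
      _ ≤ _ := by gcongr
  · calc (B * A * G * A * B) * B = B * A * G * A * (B * B) := by simp only [mul_assoc]
      _ ≤ _ := by gcongr

theorem nextS_mul_self (BB : B * B ≤ B) (GB : G ≤ B)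
    (h1 : A * B * A ≤ nextS B A G) (h2 : A * B * A * G * A ≤ nextS B A G) :
    nextS B A G * nextS B A G ≤ nextS B A G := by
  have hB : B * nextS B A G ≤ nextS B A G := B_nextS BB
  have hB' : nextS B A G * B ≤ nextS B A G := nextS_B BB
  have hA : A * nextS B A G ≤ nextS B A G := by
    conv_lhs => rw [nextS, Submodule.mul_sup]
    refine sup_le ?_ ?_
    · calc A * (B * A * B) = (A * B * A) * B := by simp only [mul_assoc]
        _ ≤ nextS B A G * B := by gcongr
        _ ≤ _ := hB'
    · calc A * (B * A * G * A * B) = (A * B * A * G * A) * B := by simp only [mul_assoc]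
        _ ≤ nextS B A G * B := by gcongr
        _ ≤ _ := hB'
  have hG : G * nextS B A G ≤ nextS B A G := le_trans (by gcongr) hB
  generalize hS : nextS B A G = S at *
  rw [nextS] at hS
  have hSS : S * S = (B * A * B) * S ⊔ (B * A * G * A * B) * S := by
    conv_lhs => rw [← hS, Submodule.sup_mul, hS]
  rw [hSS]
  have step : ∀ X : Submodule V Λ, ∀ {T}, X * S ≤ S → T ≤ S → X * T ≤ S := fun X T h h' =>
    le_trans (by gcongr) h
  refine sup_le ?_ ?_ <;> simp only [mul_assoc]
  · exact step _ hB (step _ hA hB)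
  · exact step _ hB (step _ hA (step _ hG (step _ hA hB)))

theorem base_le {b f c d a e : Λ} {t l li m μ : V}
    (h : Pair t l li m μ a e b f) (h' : Pair t l li m μ a e c d)
    (fc : Commute f c) (bd : Commute b d) (bc : Commute b c) (fd : Commute f d) :
    (Asp V b f * Asp V c d) * (Asp V b f * Asp V c d) ≤ Asp V b f * Asp V c d ∧
    let S := nextS (Asp V b f * Asp V c d) (Asp V a e) (Submodule.span V {b * c})
    S * S ≤ S := by
  have com : Asp V c d * Asp V b f = Asp V b f * Asp V c d := by
    have : ∀ x ∈ Asp V b f, ∀ y ∈ Asp V c d, x * y = y * x := fun x hx y hy => by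
      refine Asp_commute (V := V) ?_ ?_ y hy
      · exact (Asp_commute (V := V) bc.symm fc.symm x hx).symm
      · exact (Asp_commute (V := V) bd.symm fd.symm x hx).symm
    apply le_antisymm
    · exact Submodule.mul_le.2 fun y hy x hx => this x hx y hy ▸ Submodule.mul_mem_mul hx hy
    · exact Submodule.mul_le.2 fun x hx y hy => this x hx y hy ▸ Submodule.mul_mem_mul hy hx
  have hbb : Asp V b f * Asp V b f ≤ Asp V b f := Asp_mul_self h.bb h.bf h.fb h.ff
  have hcc : Asp V c d * Asp V c d ≤ Asp V c d := Asp_mul_self h'.bb h'.bf h'.fb h'.ff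
  have BB : (Asp V b f * Asp V c d) * (Asp V b f * Asp V c d) ≤ Asp V b f * Asp V c d := by
    calc (Asp V b f * Asp V c d) * (Asp V b f * Asp V c d) =
          Asp V b f * (Asp V c d * Asp V b f) * Asp V c d := by simp only [mul_assoc]
      _ = (Asp V b f * Asp V b f) * (Asp V c d * Asp V c d) := by
          rw [com]; simp only [mul_assoc]
      _ ≤ _ := by gcongr
  refine ⟨BB, ?_⟩
  intro S
  have B1 : (1 : Λ) ∈ Asp V b f * Asp V c d := by
    simpa using Submodule.mul_mem_mul (one_mem_Asp (V := V) (a := b) (e := f))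
      (one_mem_Asp (V := V) (a := c) (e := d))
  have CB : Asp V b f ≤ Asp V b f * Asp V c d := fun x hx => by
    simpa using Submodule.mul_mem_mul hx (one_mem_Asp (V := V) (a := c) (e := d))
  have DB : Asp V c d ≤ Asp V b f * Asp V c d := fun x hx => by
    simpa using Submodule.mul_mem_mul (one_mem_Asp (V := V) (a := b) (e := f)) hx
  have GB : Submodule.span V {b * c} ≤ Asp V b f * Asp V c d := by
    rw [Submodule.span_singleton_le_iff_mem]
    exact Submodule.mul_mem_mul a_mem_Asp a_mem_Asp
  have h1 : Asp V a e * (Asp V b f * Asp V c d) * Asp V a e ≤ S := by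
    refine Submodule.mul_le.2 fun x hx q hq => ?_
    refine Submodule.mul_induction_on hx (fun p hp y hy => ?_) ?_
    · refine Submodule.mul_induction_on hy (fun u hu v hv => ?_) ?_
      · refine base_ABA h h' fc bd bc (Asp V b f * Asp V c d) S ?_ B1 CB DB ?_ ?_ ?_ ?_
          p hp u hu v hv q hq
        · exact fun x hx y hy => BB (Submodule.mul_mem_mul hx hy)
        · exact fun x hx p hp y hy => le_nextS1
            (Submodule.mul_mem_mul (Submodule.mul_mem_mul hx hp) hy)
        · intro p hp q hq
          have := Submodule.mul_mem_mul (Submodule.mul_mem_mul (Submodule.mul_mem_mul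
            (Submodule.mul_mem_mul B1 hp) (Submodule.mem_span_singleton_self (R := V) (b * c))) hq)
            B1
          simp only [one_mul, mul_one] at this
          exact le_nextS2 this
        · exact fun x hx s hs => B_nextS BB (Submodule.mul_mem_mul hx hs)
        · exact fun s hs x hx => nextS_B BB (Submodule.mul_mem_mul hs hx)
      · intro x y hx hy
        rw [mul_add, add_mul]; exact add_mem hx hy
    · intro x y hx hy
      rw [add_mul]; exact add_mem hx hy
  refine nextS_mul_self BB GB h1 ?_
  have h3 : Asp V c d * Asp V a e * Asp V c d ≤ Asp V a e * Asp V c d * Asp V a e := h'.symm.aca_le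
  have h4 : Asp V a e * Asp V b f * Asp V a e ≤ Asp V b f * Asp V a e * Asp V b f := h.aca_le
  have h5 : Asp V b f * S ≤ S := le_trans (by gcongr) (B_nextS BB)
  have h6 : S * Asp V b f ≤ S := le_trans (by gcongr) (nextS_B BB)
  change _ ≤ S
  clear_value S
  generalize Submodule.span V {b * c} = G at *
  generalize Asp V b f = X at *
  generalize Asp V c d = Y at *
  generalize Asp V a e = A at *
  calc A * (X * Y) * A * G * A ≤ A * (X * Y) * A * (X * Y) * A := by gcongr
    _ = A * X * (Y * A * (X * Y)) * A := by simp only [mul_assoc]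
    _ = A * X * (Y * A * Y) * X * A := by rw [← com]; simp only [mul_assoc]
    _ ≤ A * X * (A * Y * A) * X * A := by gcongr
    _ = (A * X * A) * Y * (A * X * A) := by simp only [mul_assoc]
    _ ≤ (X * A * X) * Y * (X * A * X) := by gcongr
    _ = X * A * X * (Y * X) * A * X := by simp only [mul_assoc]
    _ = X * A * (X * X) * Y * A * X := by rw [com]; simp only [mul_assoc]
    _ ≤ X * A * X * Y * A * X := by gcongr
    _ = X * (A * (X * Y) * A) * X := by simp only [mul_assoc]
    _ ≤ X * S * X := by gcongr
    _ ≤ S * X := by gcongr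
    _ ≤ S := h6

theorem one_mem_nextS (B1 : (1 : Λ) ∈ B) (A1 : (1 : Λ) ∈ A) : (1 : Λ) ∈ nextS B A G := by
  simpa using le_nextS1 (G := G) (Submodule.mul_mem_mul (Submodule.mul_mem_mul B1 A1) B1)

theorem B_le_nextS (B1 : (1 : Λ) ∈ B) (A1 : (1 : Λ) ∈ A) : B ≤ nextS B A G := fun x hx => by
  simpa using le_nextS1 (G := G) (Submodule.mul_mem_mul (Submodule.mul_mem_mul hx A1) B1)

theorem A_le_nextS (B1 : (1 : Λ) ∈ B) : A ≤ nextS B A G := fun x hx => by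
  simpa using le_nextS1 (G := G) (Submodule.mul_mem_mul (Submodule.mul_mem_mul B1 hx) B1)

theorem step_le {b f a e : Λ} {t l li m μ : V} (h : Pair t l li m μ a e b f) {H Hi z : Λ}
    (hHi : H * Hi = 1) (hz : f * H * b * H = z * f) (Bm : Submodule V Λ)
    (Bm1 : (1 : Λ) ∈ Bm) (BmBm : Bm * Bm ≤ Bm) (HBm : H ∈ Bm) (HiBm : Hi ∈ Bm)
    (hcom : ∀ x ∈ Bm, Commute x a ∧ Commute x e)
    (BB : nextS Bm (Asp V b f) (Submodule.span V {H}) * nextS Bm (Asp V b f) (Submodule.span V {H})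
      ≤ nextS Bm (Asp V b f) (Submodule.span V {H}))
    (tw : Bm * Submodule.span V {b * H * b} ≤ Submodule.span V {b * H * b} * Bm) :
    let S := nextS (nextS Bm (Asp V b f) (Submodule.span V {H})) (Asp V a e)
      (Submodule.span V {b * H * b})
    S * S ≤ S := by
  intro S
  have com : Bm * Asp V a e = Asp V a e * Bm := by
    have : ∀ x ∈ Bm, ∀ y ∈ Asp V a e, x * y = y * x := fun x hx y hy =>
      Asp_commute (V := V) (hcom x hx).1 (hcom x hx).2 y hy
    apply le_antisymm
    · exact Submodule.mul_le.2 fun x hx y hy => this x hx y hy ▸ Submodule.mul_mem_mul hy hx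
    · exact Submodule.mul_le.2 fun y hy x hx => this x hx y hy ▸ Submodule.mul_mem_mul hx hy
  have comH : Submodule.span V {H} * Asp V a e = Asp V a e * Submodule.span V {H} := by
    have : ∀ x ∈ Submodule.span V {H}, ∀ y ∈ Asp V a e, x * y = y * x := fun x hx y hy => by
      obtain ⟨r, rfl⟩ := Submodule.mem_span_singleton.1 hx
      rw [smul_mul_assoc, mul_smul_comm, Asp_commute (V := V) (hcom H HBm).1 (hcom H HBm).2 y hy]
    apply le_antisymm
    · exact Submodule.mul_le.2 fun x hx y hy => this x hx y hy ▸ Submodule.mul_mem_mul hy hx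
    · exact Submodule.mul_le.2 fun y hy x hx => this x hx y hy ▸ Submodule.mul_mem_mul hx hy
  have BmB : Bm ≤ nextS Bm (Asp V b f) (Submodule.span V {H}) := B_le_nextS Bm1 one_mem_Asp
  have CB : Asp V b f ≤ nextS Bm (Asp V b f) (Submodule.span V {H}) := A_le_nextS Bm1
  have HB : Submodule.span V {H} ≤ nextS Bm (Asp V b f) (Submodule.span V {H}) := by
    rw [Submodule.span_singleton_le_iff_mem]; exact BmB HBm
  have B1 := BmB Bm1
  have hCC : Asp V b f * Asp V b f ≤ Asp V b f := Asp_mul_self h.bb h.bf h.fb h.ff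
  have GC : Submodule.span V {b * H * b} ≤ Asp V b f * Submodule.span V {H} * Asp V b f := by
    rw [Submodule.span_singleton_le_iff_mem]
    exact Submodule.mul_mem_mul (Submodule.mul_mem_mul a_mem_Asp
      (Submodule.mem_span_singleton_self _)) a_mem_Asp
  have CAC : Asp V b f * Asp V a e * Asp V b f ≤ Asp V a e * Asp V b f * Asp V a e := h.symm.aca_le
  have ACA : Asp V a e * Asp V b f * Asp V a e ≤ Asp V b f * Asp V a e * Asp V b f := h.aca_le
  have main : Asp V a e * Asp V b f * Submodule.span V {H} * Asp V b f * Asp V a e ≤ S := by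
    have := achca h (hcom H HBm).1 (hcom H HBm).2 hHi hz
      (nextS Bm (Asp V b f) (Submodule.span V {H})) S
      (fun x hx y hy => BB (Submodule.mul_mem_mul hx hy)) B1 CB (BmB HBm) (BmB HiBm)
      (fun x hx p hp y hy => le_nextS1
            (Submodule.mul_mem_mul (Submodule.mul_mem_mul hx hp) hy))
      ?_ (fun x hx s hs => B_nextS BB (Submodule.mul_mem_mul hx hs))
      (fun s hs x hx => nextS_B BB (Submodule.mul_mem_mul hs hx))
    · refine Submodule.mul_le.2 fun x hx q hq => ?_
      refine Submodule.mul_induction_on hx (fun x hx c' hc' => ?_) ?_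
      · refine Submodule.mul_induction_on hx (fun x hx H' hH' => ?_) ?_
        · obtain ⟨r, rfl⟩ := Submodule.mem_span_singleton.1 hH'
          refine Submodule.mul_induction_on hx (fun p hp c hc => ?_) ?_
          · simp only [mul_smul_comm, smul_mul_assoc]
            exact Submodule.smul_mem _ _ (this p hp c hc c' hc' q hq)
          · intro x y hx hy
            simp only [add_mul]; exact add_mem hx hy
        · intro x y hx hy
          simp only [add_mul]; exact add_mem hx hy
      · intro x y hx hy
        simp only [add_mul]; exact add_mem hx hy
    · intro p hp q hq
      have := Submodule.mul_mem_mul (Submodule.mul_mem_mul (Submodule.mul_mem_mul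
        (Submodule.mul_mem_mul B1 hp)
        (Submodule.mem_span_singleton_self (R := V) (b * H * b))) hq) B1
      simp only [one_mul, mul_one] at this
      exact le_nextS2 this
  have BS : nextS Bm (Asp V b f) (Submodule.span V {H}) * S ≤ S := B_nextS BB
  have SB : S * nextS Bm (Asp V b f) (Submodule.span V {H}) ≤ S := nextS_B BB
  have BAB : nextS Bm (Asp V b f) (Submodule.span V {H}) * Asp V a e *
    nextS Bm (Asp V b f) (Submodule.span V {H}) ≤ S := le_nextS1
  have GB : Submodule.span V {b * H * b} ≤ nextS Bm (Asp V b f) (Submodule.span V {H}) := by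
    refine GC.trans (le_trans ?_ (le_nextS2.trans le_rfl))
    have : ∀ X : Submodule V Λ, X ≤ Bm * X * Bm := fun X x hx => by
      simpa using Submodule.mul_mem_mul (Submodule.mul_mem_mul Bm1 hx) Bm1
    refine (this _).trans ?_
    simp only [mul_assoc]; rfl
  have fin := nextS_mul_self (A := Asp V a e) BB GB
  change _ → _ → S * S ≤ S at fin
  change _ → (_ ≤ S) → S * S ≤ S at fin
  change (_ ≤ S) → (_ ≤ S) → S * S ≤ S at fin
  clear_value S
  have Bdef : nextS Bm (Asp V b f) (Submodule.span V {H}) =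
    Bm * Asp V b f * Bm ⊔ Bm * Asp V b f * Submodule.span V {H} * Asp V b f * Bm := rfl
  generalize nextS Bm (Asp V b f) (Submodule.span V {H}) = B at *
  generalize Submodule.span V {b * H * b} = G at *
  generalize Submodule.span V {H} = h at *
  generalize Asp V b f = C at *
  generalize Asp V a e = A at *
  have comA : ∀ X, Bm * (A * X) = A * (Bm * X) := fun X => by rw [← mul_assoc, com, mul_assoc]
  have BmS : Bm * S ≤ S := le_trans (by gcongr) BS
  have SBm : S * Bm ≤ S := le_trans (by gcongr) SB
  have CS : C * S ≤ S := le_trans (by gcongr) BS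
  have SC : S * C ≤ S := le_trans (by gcongr) SB
  have mid : ∀ X Y : Submodule V Λ, X * S ≤ S → S * Y ≤ S → ∀ T, T ≤ S → X * T * Y ≤ S := by
    intro X Y hX hY T hT
    calc X * T * Y ≤ X * S * Y := by gcongr
      _ ≤ S * Y := by gcongr
      _ ≤ S := hY
  have hABA : A * B * A ≤ S := by
    rw [Bdef, Submodule.mul_sup, Submodule.sup_mul]
    refine sup_le ?_ ?_
    · calc A * (Bm * C * Bm) * A = (A * Bm) * C * (Bm * A) := by simp only [mul_assoc]
        _ = Bm * (A * C * A) * Bm := by simp only [mul_assoc, com, comA]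
        _ ≤ S := mid _ _ BmS SBm _ ?_
      calc A * C * A ≤ C * A * C := ACA
        _ ≤ B * A * B := by gcongr
        _ ≤ S := BAB
    · calc A * (Bm * C * h * C * Bm) * A = (A * Bm) * C * h * C * (Bm * A) := by
            simp only [mul_assoc]
        _ = Bm * (A * C * h * C * A) * Bm := by
            simp only [mul_assoc, com, comA]
        _ ≤ S := mid _ _ BmS SBm _ main
  refine fin hABA ?_
  have ACAGA : A * C * A * G * A ≤ S := by
    calc A * C * A * G * A ≤ (C * A * C) * (C * h * C) * A := by gcongr
      _ = C * A * (C * C) * h * C * A := by simp only [mul_assoc]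
      _ ≤ C * A * C * h * C * A := by gcongr
      _ = C * (A * C * h * C * A) := by simp only [mul_assoc]
      _ ≤ C * S := by gcongr
      _ ≤ S := CS
  have ACHCAGA : A * C * h * C * A * G * A ≤ S := by
    calc A * C * h * C * A * G * A ≤ A * C * h * C * A * (C * h * C) * A := by gcongr
      _ = A * C * h * (C * A * C) * h * C * A := by simp only [mul_assoc]
      _ ≤ A * C * h * (A * C * A) * h * C * A := by gcongr
      _ = A * C * (h * A) * C * A * h * C * A := by simp only [mul_assoc]
      _ = A * C * A * h * C * (A * h) * C * A := by rw [comH]; simp only [mul_assoc]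
      _ = (A * C * A) * h * C * h * (A * C * A) := by rw [← comH]; simp only [mul_assoc]
      _ ≤ (C * A * C) * h * C * h * (C * A * C) := by gcongr
      _ = C * (A * (C * h * C * h * C) * A) * C := by simp only [mul_assoc]
      _ ≤ S := mid _ _ CS SC _ ?_
    have : C * h * C * h * C ≤ B := by
      calc C * h * C * h * C ≤ B * B * B * B * B := by gcongr
        _ ≤ B * B * B * B := by gcongr
        _ ≤ B * B * B := by gcongr
        _ ≤ B * B := by gcongr
        _ ≤ B := BB
    exact le_trans (by gcongr) hABA
  conv_lhs => rw [Bdef]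
  rw [Submodule.mul_sup, Submodule.sup_mul, Submodule.sup_mul, Submodule.sup_mul]
  refine sup_le ?_ ?_
  · calc A * (Bm * C * Bm) * A * G * A = (A * Bm) * C * (Bm * A) * G * A := by simp only [mul_assoc]
      _ = Bm * A * C * A * (Bm * G) * A := by simp only [mul_assoc, com, comA]
      _ ≤ Bm * A * C * A * (G * Bm) * A := by gcongr
      _ = Bm * A * C * A * G * (Bm * A) := by simp only [mul_assoc]
      _ = Bm * (A * C * A * G * A) * Bm := by simp only [mul_assoc, com, comA]
      _ ≤ S := mid _ _ BmS SBm _ ACAGA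
  · calc A * (Bm * C * h * C * Bm) * A * G * A = (A * Bm) * C * h * C * (Bm * A) * G * A := by
          simp only [mul_assoc]
      _ = Bm * A * C * h * C * A * (Bm * G) * A := by
          simp only [mul_assoc, com, comA]
      _ ≤ Bm * A * C * h * C * A * (G * Bm) * A := by gcongr
      _ = Bm * A * C * h * C * A * G * (Bm * A) := by simp only [mul_assoc]
      _ = Bm * (A * C * h * C * A * G * A) * Bm := by simp only [mul_assoc, com, comA]
      _ ≤ S := mid _ _ BmS SBm _ ACHCAGA

end
end BMWProof

namespace BMWProof

/-- Adjacency in type `D`, on natural numbers. -/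
def adjN (i j : ℕ) : Prop :=
  (i = 0 ∧ j = 2) ∨ (j = 0 ∧ i = 2) ∨ (1 ≤ i ∧ j = i + 1) ∨ (1 ≤ j ∧ i = j + 1)

/-- The rescaled BMW relations. -/
structure BRel {V Λ : Type*} [CommRing V] [Ring Λ] [Algebra V Λ]
    (n : ℕ) (t l li m μ : V) (g f : ℕ → Λ) : Prop where
  pair : ∀ i j, i < n → j < n → adjN i j → Pair t l li m μ (g i) (f i) (g j) (f j)
  gg : ∀ i j, i < n → j < n → i ≠ j → ¬ adjN i j → Commute (g i) (g j)
  fg : ∀ i j, i < n → j < n → i ≠ j → ¬ adjN i j → Commute (f i) (g j)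
  ff : ∀ i j, i < n → j < n → i ≠ j → ¬ adjN i j → Commute (f i) (f j)
  aa : ∀ i, i < n → g i * g i = 1 - m • g i + (μ * li) • f i
  ae : ∀ i, i < n → g i * f i = li • f i
  ea : ∀ i, i < n → f i * g i = li • f i
  ee : ∀ i, i < n → f i * f i = f i

section
variable {V Λ : Type*} [CommRing V] [Ring Λ] [Algebra V Λ]
  {n : ℕ} {t l li m μ : V} {g f : ℕ → Λ}

/-- The elements `G_k`. -/
def Gw (g : ℕ → Λ) : ℕ → Λ
  | 0 => g 0 * g 1
  | k + 1 => g (k + 2) * Gw g k * g (k + 2)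

/-- Their inverses. -/
def Gi (m μ : V) (g f : ℕ → Λ) : ℕ → Λ
  | 0 => inv' m μ (g 0) (f 0) * inv' m μ (g 1) (f 1)
  | k + 1 => inv' m μ (g (k + 2)) (f (k + 2)) * Gi m μ g f k * inv' m μ (g (k + 2)) (f (k + 2))

/-- The spanning submodules. -/
def Bs (V : Type*) {Λ : Type*} [CommRing V] [Ring Λ] [Algebra V Λ] (g f : ℕ → Λ) :
    ℕ → Submodule V Λ
  | 0 => Asp V (g 0) (f 0) * Asp V (g 1) (f 1)
  | k + 1 => nextS (Bs V g f k) (Asp V (g (k + 2)) (f (k + 2))) (Submodule.span V {Gw g k})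

theorem one_mem_Bs (k : ℕ) : (1 : Λ) ∈ Bs V g f k := by
  induction k with
  | zero =>
    rw [Bs]
    simpa using Submodule.mul_mem_mul (one_mem_Asp (V := V) (a := g 0) (e := f 0))
      (one_mem_Asp (V := V) (a := g 1) (e := f 1))
  | succ k ih => exact one_mem_nextS ih one_mem_Asp

theorem Bs_succ (k : ℕ) : Bs V g f k ≤ Bs V g f (k + 1) :=
  B_le_nextS (one_mem_Bs k) one_mem_Asp

theorem Asp_le_Bs_succ (k : ℕ) : Asp V (g (k + 2)) (f (k + 2)) ≤ Bs V g f (k + 1) :=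
  A_le_nextS (one_mem_Bs k)

theorem Asp_le_Bs (k i : ℕ) (hi : i < k + 2) : Asp V (g i) (f i) ≤ Bs V g f k := by
  induction k with
  | zero =>
    intro x hx
    rw [Bs]
    obtain rfl | rfl : i = 0 ∨ i = 1 := by omega
    · simpa using Submodule.mul_mem_mul hx (one_mem_Asp (V := V) (a := g 1) (e := f 1))
    · simpa using Submodule.mul_mem_mul (one_mem_Asp (V := V) (a := g 0) (e := f 0)) hx
  | succ k ih =>
    obtain hi | rfl : i < k + 2 ∨ i = k + 2 := by omega
    · exact (ih hi).trans (Bs_succ k)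
    · exact Asp_le_Bs_succ k

theorem Bs_fg (k : ℕ) : (Bs V g f k).FG := by
  have hA : ∀ a e : Λ, (Asp V a e).FG := fun a e => Submodule.fg_span (by simp)
  induction k with
  | zero => exact (hA _ _).mul (hA _ _)
  | succ k ih =>
    have hG : (Submodule.span V {Gw g k}).FG := Submodule.fg_span (by simp)
    exact ((ih.mul (hA _ _)).mul ih).sup ((((ih.mul (hA _ _)).mul hG).mul (hA _ _)).mul ih)

theorem Gw_mem_Bs (k : ℕ) : Gw g k ∈ Bs V g f k := by
  induction k with
  | zero => exact Submodule.mul_mem_mul a_mem_Asp a_mem_Asp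
  | succ k ih =>
    refine le_nextS2 ?_
    rw [Gw]
    have := Submodule.mul_mem_mul (Submodule.mul_mem_mul (Submodule.mul_mem_mul
      (Submodule.mul_mem_mul (one_mem_Bs (V := V) (g := g) (f := f) k)
        (a_mem_Asp (V := V) (a := g (k+2)) (e := f (k + 2))))
        (Submodule.mem_span_singleton_self (R := V) (Gw g k)))
        (a_mem_Asp (V := V) (a := g (k+2)) (e := f (k + 2)))) (one_mem_Bs (V := V) (g := g) (f := f) k)
    simpa only [one_mul, mul_one] using this

theorem Gi_mem_Bs (k : ℕ) (hB : ∀ j ≤ k, Bs V g f j * Bs V g f j ≤ Bs V g f j) :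
    Gi m μ g f k ∈ Bs V g f k := by
  induction k with
  | zero => exact Submodule.mul_mem_mul inv'_mem inv'_mem
  | succ k ih =>
    have h1 := Asp_le_Bs_succ (V := V) (g := g) (f := f) k
      (inv'_mem (m := m) (μ := μ) (a := g (k + 2)) (e := f (k + 2)))
    have h2 := Bs_succ k (ih fun j hj => hB j (by omega))
    have h3 := hB (k + 1) le_rfl
    exact h3 (Submodule.mul_mem_mul (h3 (Submodule.mul_mem_mul h1 h2)) h1)

theorem commute_of_mem_Asp {x a e : Λ} (ha : Commute a x) (he : Commute e x) :
    ∀ p ∈ Asp V a e, Commute p x := fun p hp =>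
  (Asp_commute (V := V) ha.symm he.symm p hp).symm


theorem BRel.Gw_Gi (hr : BRel n t l li m μ g f) (k : ℕ) (hk : k + 2 ≤ n) : Gw g k * Gi m μ g f k = 1 := by
  have hi : ∀ i, i < n → g i * inv' m μ (g i) (f i) = 1 := fun i hi =>
    mul_inv' (hr.aa i hi) (hr.ae i hi)
  induction k with
  | zero =>
    have hc : Commute (inv' m μ (g 0) (f 0)) (g 1) :=
      commute_of_mem_Asp (V := V) (hr.gg 0 1 (by omega) (by omega) (by omega) (by simp [adjN]))
        (hr.fg 0 1 (by omega) (by omega) (by omega) (by simp [adjN])) _ inv'_mem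
    calc Gw g 0 * Gi m μ g f 0 = g 0 * (g 1 * inv' m μ (g 0) (f 0)) * inv' m μ (g 1) (f 1) := by
          simp only [Gw, Gi, mul_assoc]
      _ = g 0 * inv' m μ (g 0) (f 0) * (g 1 * inv' m μ (g 1) (f 1)) := by
          rw [← hc.eq]; simp only [mul_assoc]
      _ = 1 := by rw [hi 0 (by omega), hi 1 (by omega), mul_one]
  | succ k ih =>
    calc Gw g (k + 1) * Gi m μ g f (k + 1) = g (k + 2) * Gw g k * (g (k + 2) *
          inv' m μ (g (k + 2)) (f (k + 2))) * Gi m μ g f k * inv' m μ (g (k + 2)) (f (k + 2)) := by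
          simp only [Gw, Gi, mul_assoc]
      _ = g (k + 2) * (Gw g k * Gi m μ g f k) * inv' m μ (g (k + 2)) (f (k + 2)) := by
          rw [hi _ (by omega)]; simp only [mul_assoc, one_mul]
      _ = 1 := by rw [ih (by omega), mul_one, hi _ (by omega)]

/-- Commutation of `Bs k` with far nodes. -/
theorem BRel.Bs_comm (hr : BRel n t l li m μ g f) (k j : ℕ) (hj : k + 3 ≤ j) (hjn : j < n) :
    ∀ x ∈ Bs V g f k, Commute x (g j) ∧ Commute x (f j) := by
  have hA : ∀ i, i + 2 ≤ j → 3 ≤ j → ∀ x ∈ Asp V (g i) (f i), Commute x (g j) ∧ Commute x (f j) := by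
    intro i hi hj3 x hx
    have hna : ¬ adjN i j := by unfold adjN; omega
    have hna' : ¬ adjN j i := by unfold adjN; omega
    exact ⟨commute_of_mem_Asp (V := V) (hr.gg i j (by omega) hjn (by omega) hna)
        (hr.fg i j (by omega) hjn (by omega) hna) x hx,
      commute_of_mem_Asp (V := V) (hr.fg j i hjn (by omega) (by omega) hna').symm
        (hr.ff i j (by omega) hjn (by omega) hna) x hx⟩
  -- the centralizer as a submodule
  obtain ⟨Z, hZ⟩ : ∃ Z : Subalgebra V Λ, ∀ x, x ∈ Z ↔ (Commute x (g j) ∧ Commute x (f j)) :=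
    ⟨Subalgebra.centralizer V {g j, f j}, fun x => by
      simp only [Subalgebra.mem_centralizer_iff, Set.mem_insert_iff, Set.mem_singleton_iff,
        forall_eq_or_imp, forall_eq]
      exact ⟨fun h => ⟨h.1.symm, h.2.symm⟩, fun h => ⟨h.1.symm, h.2.symm⟩⟩⟩
  have ZZ : ∀ {X Y : Submodule V Λ}, X ≤ Subalgebra.toSubmodule Z → Y ≤ Subalgebra.toSubmodule Z →
      X * Y ≤ Subalgebra.toSubmodule Z := fun hX hY =>
    Submodule.mul_le.2 fun x hx y hy => Z.mul_mem (hX hx) (hY hy)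
  have hA' : ∀ i, i + 2 ≤ j → 3 ≤ j → Asp V (g i) (f i) ≤ Subalgebra.toSubmodule Z :=
    fun i hi h3 x hx => (hZ x).2 (hA i hi h3 x hx)
  suffices Bs V g f k ≤ Subalgebra.toSubmodule Z from fun x hx => (hZ x).1 (this hx)
  induction k with
  | zero => exact ZZ (hA' 0 (by omega) (by omega)) (hA' 1 (by omega) (by omega))
  | succ k ih =>
    have ih := ih (by omega)
    have h2 := hA' (k + 2) (by omega) (by omega)
    have h3 : Submodule.span V {Gw g k} ≤ Subalgebra.toSubmodule Z := by
      rw [Submodule.span_singleton_le_iff_mem]; exact ih (Gw_mem_Bs k)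
    exact sup_le (ZZ (ZZ ih h2) ih) (ZZ (ZZ (ZZ (ZZ ih h2) h3) h2) ih)

/-- The swap of `0` and `1`. -/
def sw (i : ℕ) : ℕ := if i = 0 then 1 else if i = 1 then 0 else i

theorem BRel.twist0 (hr : BRel n t l li m μ g f) (i i' : ℕ) (h0 : (i = 0 ∧ i' = 1) ∨ (i = 1 ∧ i' = 0)) (hn : 3 ≤ n) :
    Gw g 1 * g i = g i' * Gw g 1 ∧ Gw g 1 * f i = f i' * Gw g 1 := by
  have hc : Commute (g i) (g i') := hr.gg i i' (by omega) (by omega) (by omega)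
    (by unfold adjN; omega)
  have hG : Gw g 1 = g 2 * g i' * g i * g 2 := by
    obtain ⟨rfl, rfl⟩ | ⟨rfl, rfl⟩ := h0
    · simp only [Gw, zero_add, mul_assoc]
      rw [← mul_assoc (g 0), hc.eq, mul_assoc]
    · simp only [Gw, zero_add, mul_assoc]
  have p1 := hr.pair 2 i (by omega) (by omega) (by unfold adjN; omega)
  have p2 := hr.pair 2 i' (by omega) (by omega) (by unfold adjN; omega)
  rw [hG]
  constructor
  · calc g 2 * g i' * g i * g 2 * g i = g 2 * g i' * (g i * g 2 * g i) := by simp only [mul_assoc]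
      _ = (g 2 * g i' * g 2) * g i * g 2 := by rw [← p1.aba]; simp only [mul_assoc]
      _ = _ := by rw [p2.aba]; simp only [mul_assoc]
  · calc g 2 * g i' * g i * g 2 * f i = g 2 * g i' * (g i * g 2 * f i) := by simp only [mul_assoc]
      _ = (g 2 * g i' * f 2) * g i * g 2 := by rw [p1.baf]; simp only [mul_assoc]
      _ = _ := by rw [p2.abe]; simp only [mul_assoc]

theorem BRel.twist (hr : BRel n t l li m μ g f) (k : ℕ) (hk : k + 3 ≤ n) (i : ℕ) (hi : i < k + 2) :
    Gw g (k + 1) * g i = g (sw i) * Gw g (k + 1) ∧ Gw g (k + 1) * f i = f (sw i) * Gw g (k + 1) := by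
  induction k generalizing i with
  | zero =>
    refine hr.twist0 i (sw i) ?_ hk
    unfold sw; split_ifs <;> omega
  | succ k ih =>
    have hG : Gw g (k + 1 + 1) = g (k + 3) * Gw g (k + 1) * g (k + 3) := rfl
    by_cases hi2 : i < k + 2
    · obtain ⟨h1, h2⟩ := ih (by omega) i hi2
      have hs : sw i < k + 2 := by unfold sw; split_ifs <;> omega
      have na : ¬ adjN i (k + 3) := by unfold adjN; omega
      have na' : ¬ adjN (sw i) (k + 3) := by unfold adjN; omega
      have c1 := hr.gg i (k + 3) (by omega) (by omega) (by omega) na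
      have c2 := hr.fg i (k + 3) (by omega) (by omega) (by omega) na
      have c3 := hr.gg (sw i) (k + 3) (by omega) (by omega) (by omega) na'
      have c4 := hr.fg (sw i) (k + 3) (by omega) (by omega) (by omega) na'
      rw [hG]
      constructor
      · rw [mul_assoc, ← c1.eq, ← mul_assoc, mul_assoc (g (k + 3)), h1, ← mul_assoc, ← c3.eq]
        simp only [mul_assoc]
      · rw [mul_assoc, ← c2.eq, ← mul_assoc, mul_assoc (g (k + 3)), h2, ← mul_assoc, ← c4.eq]
        simp only [mul_assoc]
    · obtain rfl : i = k + 2 := by omega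
      have hs : sw (k + 2) = k + 2 := by simp [sw]
      have p := hr.pair (k + 3) (k + 2) (by omega) (by omega) (by unfold adjN; omega)
      obtain ⟨cg, cf⟩ := hr.Bs_comm k (k + 3) (by omega) (by omega) _ (Gw_mem_Bs k)
      have hG' : Gw g (k + 1) = g (k + 2) * Gw g k * g (k + 2) := rfl
      rw [hs, hG, hG']
      generalize g (k + 2) = b at *
      generalize g (k + 3) = a at *
      generalize f (k + 3) = e at *
      generalize f (k + 2) = f at *
      generalize Gw g k = H at *
      constructor
      · calc a * (b * H * b) * a * b = a * b * H * (b * a * b) := by simp only [mul_assoc]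
          _ = a * b * (H * a) * b * a := by rw [← p.aba]; simp only [mul_assoc]
          _ = (a * b * a) * H * b * a := by rw [cg.eq]; simp only [mul_assoc]
          _ = _ := by rw [p.aba]; simp only [mul_assoc]
      · calc a * (b * H * b) * a * f = a * b * H * (b * a * f) := by simp only [mul_assoc]
          _ = a * b * (H * e) * b * a := by rw [p.baf]; simp only [mul_assoc]
          _ = (a * b * e) * H * b * a := by rw [cf.eq]; simp only [mul_assoc]
          _ = _ := by rw [p.abe]; simp only [mul_assoc]

theorem BRel.exists_z (hr : BRel n t l li m μ g f) (k : ℕ) (hk : k + 3 ≤ n) :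
    ∃ z, f (k + 2) * Gw g k * g (k + 2) * Gw g k = z * f (k + 2) := by
  induction k with
  | zero =>
    have p1 := hr.pair 2 0 (by omega) (by omega) (by unfold adjN; omega)
    have p2 := hr.pair 2 1 (by omega) (by omega) (by unfold adjN; omega)
    exact ⟨_, eGaG_base p1 p2 (hr.fg 0 1 (by omega) (by omega) (by omega) (by simp [adjN]))
      (hr.gg 0 1 (by omega) (by omega) (by omega) (by simp [adjN]))⟩
  | succ k ih =>
    obtain ⟨z, hz⟩ := ih (by omega)
    have p := hr.pair (k + 3) (k + 2) (by omega) (by omega) (by unfold adjN; omega)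
    obtain ⟨cg, cf⟩ := hr.Bs_comm k (k + 3) (by omega) (by omega) _ (Gw_mem_Bs k)
    exact ⟨_, eGaG p cg cf hz⟩

theorem BRel.A01 (hr : BRel n t l li m μ g f) (hn : 2 ≤ n) : Asp V (g 1) (f 1) * Asp V (g 0) (f 0) ≤
    Asp V (g 0) (f 0) * Asp V (g 1) (f 1) := by
  refine Submodule.mul_le.2 fun y hy x hx => ?_
  have hna : ¬ adjN 0 1 := by unfold adjN; omega
  have hna' : ¬ adjN 1 0 := by unfold adjN; omega
  have c1 : Commute x (g 1) := commute_of_mem_Asp (V := V)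
    (hr.gg 0 1 (by omega) (by omega) (by omega) hna)
    (hr.fg 0 1 (by omega) (by omega) (by omega) hna) x hx
  have c2 : Commute x (f 1) := commute_of_mem_Asp (V := V)
    (hr.fg 1 0 (by omega) (by omega) (by omega) hna').symm
    (hr.ff 0 1 (by omega) (by omega) (by omega) hna) x hx
  have : Commute y x := commute_of_mem_Asp (V := V) c1.symm c2.symm y hy
  rw [this.eq]; exact Submodule.mul_mem_mul hx hy

theorem BRel.Bs_tw (hr : BRel n t l li m μ g f) (k : ℕ) (hk : k + 3 ≤ n) (j : ℕ) (hj : j ≤ k) :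
    Bs V g f j * Submodule.span V {Gw g (k + 1)} ≤ Submodule.span V {Gw g (k + 1)} * Bs V g f j := by
  have sws : ∀ i, sw (sw i) = i := by intro i; unfold sw; grind
  have swl : ∀ i, i < k + 2 → sw i < k + 2 := by intro i; unfold sw; split_ifs <;> omega
  have h1 : ∀ i, i < k + 2 → g i * Gw g (k + 1) = Gw g (k + 1) * g (sw i) := fun i hi => by
    have := (hr.twist k hk (sw i) (swl i hi)).1
    rw [sws] at this; exact this.symm
  have h2 : ∀ i, i < k + 2 → f i * Gw g (k + 1) = Gw g (k + 1) * f (sw i) := fun i hi => by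
    have := (hr.twist k hk (sw i) (swl i hi)).2
    rw [sws] at this; exact this.symm
  generalize Gw g (k + 1) = G at *
  have hA : ∀ i, i < k + 2 → Asp V (g i) (f i) * Submodule.span V {G} ≤
      Submodule.span V {G} * Asp V (g (sw i)) (f (sw i)) := by
    intro i hi
    rw [Asp, Submodule.span_mul_span, Submodule.span_le]
    rintro _ ⟨x, hx, y, hy, rfl⟩
    obtain rfl := hy
    have hG := Submodule.mem_span_singleton_self (R := V) y
    obtain rfl | rfl | rfl := hx
    · have := Submodule.mul_mem_mul hG (one_mem_Asp (V := V) (a := g (sw i)) (e := f (sw i)))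
      simpa using this
    · have := Submodule.mul_mem_mul hG (a_mem_Asp (V := V) (a := g (sw i)) (e := f (sw i)))
      rw [← h1 i hi] at this; exact this
    · have := Submodule.mul_mem_mul hG (e_mem_Asp (V := V) (a := g (sw i)) (e := f (sw i)))
      rw [← h2 i hi] at this; exact this
  have hGG : ∀ j, j ≤ k → Gw g j * G = G * Gw g j := by
    intro j
    induction j with
    | zero =>
      intro _
      simp only [Gw]
      rw [mul_assoc, h1 1 (by omega), ← mul_assoc, show sw 1 = 0 from rfl, h1 0 (by omega),
        mul_assoc, show sw 0 = 1 from rfl]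
      rw [(hr.gg 0 1 (by omega) (by omega) (by omega) (by simp [adjN])).eq]
    | succ j ih =>
      intro hj
      have hs : sw (j + 2) = j + 2 := by simp [sw]
      have ha := h1 (j + 2) (by omega)
      rw [hs] at ha
      simp only [Gw]
      rw [mul_assoc, ha, ← mul_assoc, mul_assoc (g (j + 2)), ih (by omega), ← mul_assoc, ha]
      simp only [mul_assoc]
  have tw : ∀ {X Y X' Y' : Submodule V Λ}, X * Submodule.span V {G} ≤ Submodule.span V {G} * X' →
      Y * Submodule.span V {G} ≤ Submodule.span V {G} * Y' →
      (X * Y) * Submodule.span V {G} ≤ Submodule.span V {G} * (X' * Y') := by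
    intro X Y X' Y' hX hY
    calc (X * Y) * Submodule.span V {G} = X * (Y * Submodule.span V {G}) := mul_assoc _ _ _
      _ ≤ X * (Submodule.span V {G} * Y') := by gcongr
      _ = X * Submodule.span V {G} * Y' := (mul_assoc _ _ _).symm
      _ ≤ Submodule.span V {G} * X' * Y' := by gcongr
      _ = _ := mul_assoc _ _ _
  induction j with
  | zero =>
    refine (tw (hA 0 (by omega)) (hA 1 (by omega))).trans ?_
    exact mul_le_mul' le_rfl (hr.A01 (by omega))
  | succ j ih =>
    have ih := ih (by omega)
    have hs : sw (j + 2) = j + 2 := by simp [sw]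
    have ha := hA (j + 2) (by omega)
    rw [hs] at ha
    have hg : Submodule.span V {Gw g j} * Submodule.span V {G} ≤
        Submodule.span V {G} * Submodule.span V {Gw g j} := by
      rw [Submodule.span_mul_span, Submodule.span_mul_span, Set.singleton_mul_singleton,
        Set.singleton_mul_singleton, hGG j (by omega)]
    change nextS _ _ _ * _ ≤ _ * nextS _ _ _
    rw [nextS, Submodule.sup_mul, Submodule.mul_sup]
    exact sup_le_sup (tw (tw ih ha) ih) (tw (tw (tw (tw ih ha) hg) ha) ih)

theorem BRel.Bs_mul (hr : BRel n t l li m μ g f) (k : ℕ) (hk : k + 2 ≤ n) : Bs V g f k * Bs V g f k ≤ Bs V g f k := by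
  induction k using Nat.strong_induction_on with
  | _ k ih =>
  match k, hk, ih with
  | 0, hk, ih =>
    change (Asp V (g 0) (f 0) * Asp V (g 1) (f 1)) * (Asp V (g 0) (f 0) * Asp V (g 1) (f 1)) ≤
      Asp V (g 0) (f 0) * Asp V (g 1) (f 1)
    calc (Asp V (g 0) (f 0) * Asp V (g 1) (f 1)) * (Asp V (g 0) (f 0) * Asp V (g 1) (f 1)) =
        Asp V (g 0) (f 0) * (Asp V (g 1) (f 1) * Asp V (g 0) (f 0)) * Asp V (g 1) (f 1) := by
          simp only [mul_assoc]
      _ ≤ Asp V (g 0) (f 0) * (Asp V (g 0) (f 0) * Asp V (g 1) (f 1)) * Asp V (g 1) (f 1) :=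
          mul_le_mul' (mul_le_mul' le_rfl (hr.A01 hk)) le_rfl
      _ = (Asp V (g 0) (f 0) * Asp V (g 0) (f 0)) * (Asp V (g 1) (f 1) * Asp V (g 1) (f 1)) := by
          simp only [mul_assoc]
      _ ≤ _ := mul_le_mul'
          (Asp_mul_self (hr.aa 0 (by omega)) (hr.ae 0 (by omega)) (hr.ea 0 (by omega))
            (hr.ee 0 (by omega)))
          (Asp_mul_self (hr.aa 1 (by omega)) (hr.ae 1 (by omega)) (hr.ea 1 (by omega))
            (hr.ee 1 (by omega)))
  | 1, hk, ih =>
    have p1 := hr.pair 2 0 (by omega) (by omega) (by unfold adjN; omega)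
    have p2 := hr.pair 2 1 (by omega) (by omega) (by unfold adjN; omega)
    have hna : ¬ adjN 0 1 := by unfold adjN; omega
    have hna' : ¬ adjN 1 0 := by unfold adjN; omega
    exact (base_le p1 p2 (hr.fg 0 1 (by omega) (by omega) (by omega) hna)
      (hr.fg 1 0 (by omega) (by omega) (by omega) hna').symm
      (hr.gg 0 1 (by omega) (by omega) (by omega) hna)
      (hr.ff 0 1 (by omega) (by omega) (by omega) hna)).2
  | k + 2, hk, ih =>
    have p := hr.pair (k + 3) (k + 2) (by omega) (by omega) (by unfold adjN; omega)
    obtain ⟨z, hz⟩ := hr.exists_z k (by omega)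
    have hBk := ih k (by omega) (by omega)
    exact step_le p (hr.Gw_Gi k (by omega)) hz (Bs V g f k) (one_mem_Bs k) hBk (Gw_mem_Bs k)
      (Gi_mem_Bs k fun j hj => ih j (by omega) (by omega))
      (hr.Bs_comm k (k + 3) (by omega) (by omega))
      (ih (k + 1) (by omega) (by omega)) (hr.Bs_tw k (by omega) k le_rfl)

/-- Finite generation. -/
theorem BRel.adjoin_le (hr : BRel n t l li m μ g f) (hn : 2 ≤ n) : ∃ M : Submodule V Λ, M.FG ∧
    Subalgebra.toSubmodule (Algebra.adjoin V {x | ∃ i < n, x = g i ∨ x = f i}) ≤ M := by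
  refine ⟨Bs V g f (n - 2), Bs_fg _, ?_⟩
  have hm := hr.Bs_mul (n - 2) (by omega)
  have : Algebra.adjoin V {x | ∃ i < n, x = g i ∨ x = f i} ≤
      Submodule.toSubalgebra (Bs V g f (n - 2)) (one_mem_Bs _)
        (fun x y hx hy => hm (Submodule.mul_mem_mul hx hy)) := by
    rw [Algebra.adjoin_le_iff]
    rintro x ⟨i, hi, rfl | rfl⟩
    · exact Asp_le_Bs (n - 2) i (by omega) a_mem_Asp
    · exact Asp_le_Bs (n - 2) i (by omega) e_mem_Asp
  exact fun x hx => this hx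

end
end BMWProof

namespace BMWProof
section
variable {Q : Type*} [Ring Q]

/-- Conjugation by a unit. -/
def cj (w : Qˣ) (x : Q) : Q := w * x * (w⁻¹ : Qˣ)

theorem cj_one (x : Q) : cj 1 x = x := by simp [cj]
theorem cj_mul (v w : Qˣ) (x : Q) : cj (v * w) x = cj v (cj w x) := by
  simp [cj, mul_assoc]
theorem cj_mul' (v : Qˣ) (x y : Q) : cj v (x * y) = cj v x * cj v y := by
  simp [cj, mul_assoc]
theorem cj_eq_iff (v : Qˣ) (x y : Q) : cj v x = y ↔ v * x = y * v := by
  unfold cj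
  constructor
  · rintro rfl; simp [mul_assoc]
  · intro h; rw [h]; simp [mul_assoc]
theorem cj_commute (v : Qˣ) (x y : Q) : Commute (cj v x) (cj v y) ↔ Commute x y := by
  unfold Commute SemiconjBy
  rw [← cj_mul', ← cj_mul']
  constructor
  · intro h
    have := congrArg (cj v⁻¹) h
    rwa [← cj_mul, ← cj_mul, inv_mul_cancel, cj_one, cj_one] at this
  · intro h; rw [h]
theorem cj_self_of_commute {v : Qˣ} {x : Q} (h : Commute (v : Q) x) : cj v x = x := by
  rw [cj_eq_iff]; exact h.eq
theorem cj_inv_cj (v : Qˣ) (x : Q) : cj v⁻¹ (cj v x) = x := by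
  rw [← cj_mul, inv_mul_cancel, cj_one]
theorem cj_cj_inv (v : Qˣ) (x : Q) : cj v (cj v⁻¹ x) = x := by
  rw [← cj_mul, mul_inv_cancel, cj_one]
theorem cj_self_inv {v : Qˣ} {x : Q} (h : cj v x = x) : cj v⁻¹ x = x := by
  conv_lhs => rw [← h]
  exact cj_inv_cj v x

/-- One level of the tower (group part). -/
structure Lev (U Γ : Subgroup Qˣ) (Nb : Set Qˣ) (G a : Qˣ) (e : Q) : Prop where
  Ua : ∀ u ∈ U, u * a = a * u
  Ue : ∀ u ∈ U, cj u e = e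
  UΓ : U ≤ Γ
  dec : ∀ p ∈ Γ, ∃ u ∈ U, ∃ y, (y = 1 ∨ y ∈ Nb ∨ y = G) ∧ ∃ u' ∈ U, p = u * y * u'
  NbΓ : ∀ b ∈ Nb, b ∈ Γ
  GΓ : G ∈ Γ
  bb : ∀ b ∈ Nb, b * b = 1
  aa : a * a = 1
  GG : G * G = 1
  aba : ∀ b ∈ Nb, a * b * a = b * a * b
  ebe : ∀ b ∈ Nb, e * b * e = 0
  ae : cj a e = e
  bG : ∀ b ∈ Nb, ∃ H ∈ Γ, ∃ b' ∈ Nb, H * a = a * H ∧ cj H e = e ∧ b * G = H * b'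
  tw : ∀ u ∈ U, ∃ u' ∈ U, u * G = G * u'
  tw' : ∀ p ∈ Γ, ∃ p' ∈ Γ, p * (a * G * a) = (a * G * a) * p'
  caa : a * (G * a * G) = (G * a * G) * a
  cae : cj a (cj G e) = cj G e
  cee : Commute e (cj G e)

theorem inv_eq_self_of_sq {a : Qˣ} (h : a * a = 1) : a⁻¹ = a := inv_eq_of_mul_eq_one_left h

variable {U Γ : Subgroup Qˣ} {Nb : Set Qˣ} {G a : Qˣ} {e : Q}

theorem Lev.left (h : Lev U Γ Nb G a e) (p q : Qˣ) (hp : p ∈ Γ) (hq : q ∈ Γ) (x : Qˣ)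
    (hx : x = 1 ∨ x = a ∨ x = a * G * a) :
    ∃ p' ∈ Γ, ∃ x', (x' = 1 ∨ x' = a ∨ x' = a * G * a) ∧ ∃ q' ∈ Γ, a * (p * x * q) = p' * x' * q' := by
  obtain ⟨u, hu, y, hy, u', hu', rfl⟩ := h.dec p hp
  obtain rfl | rfl | rfl := hx
  · exact ⟨1, Γ.one_mem, a, by simp, _, Γ.mul_mem hp hq, by simp [mul_assoc]⟩
  · have e1 : x * (u * y * u' * x * q) = u * (x * y * x) * (u' * q) := by
      calc x * (u * y * u' * x * q) = (x * u) * y * (u' * x) * q := by simp only [mul_assoc]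
        _ = _ := by rw [← h.Ua u hu, h.Ua u' hu']; simp only [mul_assoc]
    rw [e1]
    have hq' : u' * q ∈ Γ := Γ.mul_mem (h.UΓ hu') hq
    have hu1 := h.UΓ hu
    obtain rfl | hb | rfl := hy
    · exact ⟨u, hu1, 1, by simp, _, hq', by rw [mul_one, h.aa]⟩
    · exact ⟨u * y, Γ.mul_mem hu1 (h.NbΓ y hb), x, by simp, y * (u' * q),
        Γ.mul_mem (h.NbΓ y hb) hq', by rw [h.aba y hb]; simp only [mul_assoc]⟩
    · exact ⟨u, hu1, _, Or.inr (Or.inr rfl), _, hq', rfl⟩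
  · obtain ⟨p1, hp1, e0⟩ := h.tw' u' (h.UΓ hu')
    have e1 : a * (u * y * u' * (a * G * a) * q) = u * (a * y * (a * G * a)) * (p1 * q) := by
      calc a * (u * y * u' * (a * G * a) * q) = (a * u) * y * (u' * (a * G * a)) * q := by
            simp only [mul_assoc]
        _ = _ := by rw [← h.Ua u hu, e0]; simp only [mul_assoc]
    rw [e1]
    have hq' : p1 * q ∈ Γ := Γ.mul_mem hp1 hq
    have hu1 := h.UΓ hu
    obtain rfl | hb | rfl := hy
    · refine ⟨u * G, Γ.mul_mem hu1 h.GΓ, a, by simp, _, hq', ?_⟩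
      have : a * 1 * (a * G * a) = G * a := by
        rw [mul_one, ← mul_assoc, ← mul_assoc, h.aa, one_mul]
      rw [this]; simp only [mul_assoc]
    · obtain ⟨H, hH, b', hb', Ha, He, hbG⟩ := h.bG y hb
      refine ⟨u * (y * H * b'), Γ.mul_mem hu1 (Γ.mul_mem (Γ.mul_mem (h.NbΓ y hb) hH)
        (h.NbΓ b' hb')), a, by simp, b' * (p1 * q), Γ.mul_mem (h.NbΓ b' hb') hq', ?_⟩
      have : a * y * (a * G * a) = y * H * b' * a * b' := by
        calc a * y * (a * G * a) = (a * y * a) * G * a := by simp only [mul_assoc]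
          _ = y * a * (y * G) * a := by rw [h.aba y hb]; simp only [mul_assoc]
          _ = y * (a * H) * b' * a := by rw [hbG]; simp only [mul_assoc]
          _ = y * H * (a * b' * a) := by rw [← Ha]; simp only [mul_assoc]
          _ = _ := by rw [h.aba b' hb']; simp only [mul_assoc]
      rw [this]; simp only [mul_assoc]
    · refine ⟨u * y, Γ.mul_mem hu1 h.GΓ, a, by simp, y * (p1 * q), Γ.mul_mem h.GΓ hq', ?_⟩
      have : a * y * (a * y * a) = y * a * y := by
        calc a * y * (a * y * a) = a * (y * a * y) * a := by simp only [mul_assoc]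
          _ = y * a * y * (a * a) := by rw [h.caa]; simp only [mul_assoc]
          _ = _ := by rw [h.aa, mul_one]
      rw [this]; simp only [mul_assoc]

/-- Double coset decomposition. -/
theorem Lev.decomp (h : Lev U Γ Nb G a e) : ∀ w ∈ Γ ⊔ Subgroup.zpowers a,
    ∃ p ∈ Γ, ∃ x, (x = 1 ∨ x = a ∨ x = a * G * a) ∧ ∃ q ∈ Γ, w = p * x * q := by
  intro w hw
  have hcl : Γ ⊔ Subgroup.zpowers a = Subgroup.closure (Γ ∪ {a}) := by
    rw [Subgroup.closure_union, Subgroup.closure_eq, Subgroup.zpowers_eq_closure]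
  rw [hcl] at hw
  have ha : a⁻¹ = a := inv_eq_self_of_sq h.aa
  induction hw using Subgroup.closure_induction_left with
  | one => exact ⟨1, Γ.one_mem, 1, by simp, 1, Γ.one_mem, by simp⟩
  | mul_left x hx y hy ih =>
    obtain ⟨p, hp, z, hz, q, hq, rfl⟩ := ih
    obtain hx | rfl := hx
    · exact ⟨x * p, Γ.mul_mem hx hp, z, hz, q, hq, by simp only [mul_assoc]⟩
    · exact h.left p q hp hq z hz
  | inv_mul_cancel x hx y hy ih =>
    obtain ⟨p, hp, z, hz, q, hq, rfl⟩ := ih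
    obtain hx | rfl := hx
    · exact ⟨x⁻¹ * p, Γ.mul_mem (Γ.inv_mem hx) hp, z, hz, q, hq, by simp only [mul_assoc]⟩
    · rw [ha]; exact h.left p q hp hq z hz

theorem Lev.finite (h : Lev U Γ Nb G a e) (hf : (Γ : Set Qˣ).Finite) :
    ((Γ ⊔ Subgroup.zpowers a : Subgroup Qˣ) : Set Qˣ).Finite := by
  refine ((hf.mul (Set.toFinite {1, a, a * G * a})).mul hf).subset ?_
  intro w hw
  obtain ⟨p, hp, x, hx, q, hq, rfl⟩ := h.decomp w hw
  exact Set.mul_mem_mul (Set.mul_mem_mul hp (by simpa using hx)) hq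

theorem commute_cj_inv (w : Qˣ) (e : Q) (h : Commute e (cj w e)) : Commute e (cj w⁻¹ e) := by
  rw [← cj_commute w, cj_cj_inv]; exact h.symm

theorem Lev.commute (h : Lev U Γ Nb G a e)
    (hfin : ∀ b ∈ Nb, ∀ b' ∈ Nb, ∀ z ∈ U, Commute e (cj (b * a * z * b') e)) :
    ∀ w ∈ Γ ⊔ Subgroup.zpowers a, Commute e (cj w e) := by
  -- left and right multiplication by stabilizers of `e`
  have Tl : ∀ u w : Qˣ, cj u e = e → Commute e (cj w e) → Commute e (cj (u * w) e) := by
    intro u w hu hw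
    rw [cj_mul]; conv_lhs => rw [← hu]
    rwa [cj_commute]
  have Tr : ∀ u w : Qˣ, cj u e = e → Commute e (cj w e) → Commute e (cj (w * u) e) := by
    intro u w hu hw
    rwa [cj_mul, hu]
  have Gi : G⁻¹ = G := inv_eq_self_of_sq h.GG
  have ai : a⁻¹ = a := inv_eq_self_of_sq h.aa
  have bi : ∀ b ∈ Nb, b⁻¹ = b := fun b hb => inv_eq_self_of_sq (h.bb b hb)
  have t1 : Commute e (cj 1 e) := by rw [cj_one]
  have tb : ∀ b ∈ Nb, Commute e (cj b e) := by
    intro b hb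
    unfold cj; rw [bi b hb]
    have h1 : e * (b * e * b) = 0 := by rw [← mul_assoc, ← mul_assoc, h.ebe b hb, zero_mul]
    have h2 : (b * e * b) * e = 0 := by rw [mul_assoc, mul_assoc, ← mul_assoc e, h.ebe b hb, mul_zero]
    exact h1.trans h2.symm
  have ty : ∀ y, (y = 1 ∨ y ∈ Nb ∨ y = G) → Commute e (cj y e) := by
    rintro y (rfl | hy | rfl)
    · exact t1
    · exact tb y hy
    · exact h.cee
  have tΓ : ∀ p ∈ Γ, Commute e (cj p e) := by
    intro p hp
    obtain ⟨u, hu, y, hy, u', hu', rfl⟩ := h.dec p hp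
    exact Tr _ _ (h.Ue u' hu') (Tl _ _ (h.Ue u hu) (ty y hy))
  -- `y G`
  have tyG : ∀ y, (y = 1 ∨ y ∈ Nb ∨ y = G) → Commute e (cj (y * G) e) := by
    rintro y (rfl | hb | rfl)
    · rw [one_mul]; exact h.cee
    · obtain ⟨H, hH, b', hb', Ha, He, hbG⟩ := h.bG y hb
      rw [hbG]
      exact Tl _ _ He (tb b' hb')
    · rw [h.GG]; exact t1
  have aG : cj (a * G) e = cj G e := by rw [cj_mul, h.cae]
  have tyaG : ∀ y, (y = 1 ∨ y ∈ Nb ∨ y = G) → Commute e (cj (y * (a * G)) e) := by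
    intro y hy
    rw [cj_mul, aG, ← cj_mul]; exact tyG y hy
  have typ : ∀ y, (y = 1 ∨ y ∈ Nb ∨ y = G) → ∀ z ∈ U, ∀ y', (y' = 1 ∨ y' ∈ Nb ∨ y' = G) →
      Commute e (cj (y * a * z * y') e) := by
    have hG : ∀ y, (y = 1 ∨ y ∈ Nb ∨ y = G) → ∀ z ∈ U, Commute e (cj (y * a * z * G) e) := by
      intro y hy z hz
      obtain ⟨z', hz', hzG⟩ := h.tw z hz
      have : y * a * z * G = y * (a * G) * z' := by rw [mul_assoc _ z, hzG]; simp only [mul_assoc]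
      rw [this]
      exact Tr _ _ (h.Ue z' hz') (tyaG y hy)
    rintro y hy z hz y' (rfl | hb' | rfl)
    · rw [mul_one]
      exact Tr _ _ (h.Ue z hz) (Tr _ _ h.ae (ty y hy))
    · obtain rfl | hb | rfl := hy
      · rw [one_mul]
        rw [mul_assoc]
        exact Tl _ _ h.ae (Tl _ _ (h.Ue z hz) (tb y' hb'))
      · exact hfin y hb y' hb' z hz
      · have := commute_cj_inv _ _ (hG y' (Or.inr (Or.inl hb')) z⁻¹ (U.inv_mem hz))
        have e2 : (y' * a * z⁻¹ * y)⁻¹ = y * a * z * y' := by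
          rw [mul_inv_rev, mul_inv_rev, mul_inv_rev, bi y' hb', ai, Gi, inv_inv]
          calc y * (z * (a * y')) = y * (z * a) * y' := by simp only [mul_assoc]
            _ = _ := by rw [h.Ua z hz]; simp only [mul_assoc]
        rwa [e2] at this
    · exact hG y hy z hz
  intro w hw
  obtain ⟨p, hp, x, hx, q, hq, rfl⟩ := h.decomp w hw
  obtain rfl | rfl | rfl := hx
  · rw [mul_one]; exact tΓ _ (Γ.mul_mem hp hq)
  · obtain ⟨u1, hu1, y, hy, u2, hu2, rfl⟩ := h.dec p hp
    obtain ⟨u3, hu3, y', hy', u4, hu4, rfl⟩ := h.dec q hq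
    have : u1 * y * u2 * x * (u3 * y' * u4) = u1 * (y * x * (u2 * u3) * y') * u4 := by
      calc u1 * y * u2 * x * (u3 * y' * u4) = u1 * y * (u2 * x) * (u3 * y' * u4) := by
            simp only [mul_assoc]
        _ = _ := by rw [h.Ua u2 hu2]; simp only [mul_assoc]
    rw [this]
    exact Tr _ _ (h.Ue u4 hu4) (Tl _ _ (h.Ue u1 hu1) (typ y hy _ (U.mul_mem hu2 hu3) y' hy'))
  · obtain ⟨q', hq', hpq⟩ : ∃ q' ∈ Γ, p * (a * G * a) * q = q' * (a * G * a) := by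
      -- move everything to the left using finiteness-free inverse twist
      have hq1 : q⁻¹ ∈ Γ := Γ.inv_mem hq
      obtain ⟨q1, hq1', e1⟩ := h.tw' _ hq1
      have hs : (a * G * a) * (a * G * a) = 1 := by
        calc (a * G * a) * (a * G * a) = a * G * (a * a) * G * a := by simp only [mul_assoc]
          _ = a * (G * G) * a := by rw [h.aa, mul_one]; simp only [mul_assoc]
          _ = 1 := by rw [h.GG, mul_one, h.aa]
      have hsi : (a * G * a)⁻¹ = a * G * a := inv_eq_self_of_sq hs
      have e2 := congrArg (·⁻¹) e1
      simp only [mul_inv_rev (q⁻¹), mul_inv_rev (a * G * a) q1, hsi, inv_inv] at e2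
      exact ⟨p * q1⁻¹, Γ.mul_mem hp (Γ.inv_mem hq1'), by
        rw [mul_assoc, e2]; simp only [mul_assoc]⟩
    rw [hpq]
    obtain ⟨u1, hu1, y, hy, u2, hu2, rfl⟩ := h.dec q' hq'
    obtain ⟨u3, hu3, e3⟩ := h.tw u2 hu2
    have : u1 * y * u2 * (a * G * a) = u1 * ((y * (a * G)) * (u3 * a)) := by
      calc u1 * y * u2 * (a * G * a) = u1 * y * (u2 * a) * G * a := by simp only [mul_assoc]
        _ = u1 * y * a * (u2 * G) * a := by rw [h.Ua u2 hu2]; simp only [mul_assoc]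
        _ = _ := by rw [e3]; simp only [mul_assoc]
    rw [this]
    refine Tl _ _ (h.Ue u1 hu1) (Tr _ _ ?_ (tyaG y hy))
    rw [cj_mul, h.ae, h.Ue u3 hu3]

end
end BMWProof

namespace BMWProof
section
variable {F Q : Type*} [Field F] [Ring Q] [Algebra F Q]

/-- The degenerate relations, phrased with units. -/
structure UR (n : ℕ) (u : ℕ → Qˣ) (f : ℕ → Q) : Prop where
  uu : ∀ i, i < n → u i * u i = 1
  uf : ∀ i, i < n → cj (u i) (f i) = f i
  aba : ∀ i j, i < n → j < n → adjN i j → u i * u j * u i = u j * u i * u j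
  cjf : ∀ i j, i < n → j < n → adjN i j → cj (u i * u j) (f i) = f j
  ff0 : ∀ i j, i < n → j < n → adjN i j → f i * f j = 0
  fgf : ∀ i j, i < n → j < n → adjN i j → f i * u j * f i = 0
  ugc : ∀ i j, i < n → j < n → i ≠ j → ¬ adjN i j → u i * u j = u j * u i
  ufc : ∀ i j, i < n → j < n → i ≠ j → ¬ adjN i j → cj (u j) (f i) = f i
  ffc : ∀ i j, i < n → j < n → i ≠ j → ¬ adjN i j → Commute (f i) (f j)
  idem : ∀ i, i < n → f i * f i = f i

theorem adjN_symm {i j : ℕ} (h : adjN i j) : adjN j i := by unfold adjN at *; omega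

theorem BRel.UR {n : ℕ} {g f : ℕ → Q} (hr : BRel n (0 : F) 1 1 0 0 g f) {u : ℕ → Qˣ}
    (hu : ∀ i < n, (u i : Q) = g i) : UR n u f where
  uu i hi := Units.ext (by simp [hu i hi, hr.aa i hi])
  uf i hi := by rw [cj_eq_iff, hu i hi, hr.ae i hi, hr.ea i hi]
  aba i j hi hj h := Units.ext (by simpa [hu i hi, hu j hj] using (hr.pair i j hi hj h).aba)
  cjf i j hi hj h := by
    rw [cj_eq_iff]; simpa [hu i hi, hu j hj, mul_assoc] using (hr.pair i j hi hj h).abe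
  ff0 i j hi hj h := by simpa using (hr.pair i j hi hj h).ef
  fgf i j hi hj h := by simpa [hu j hj] using (hr.pair i j hi hj h).ebe
  ugc i j hi hj h h' := Units.ext (by simpa [hu i hi, hu j hj] using (hr.gg i j hi hj h h').eq)
  ufc i j hi hj h h' := by rw [cj_eq_iff, hu j hj]; exact (hr.fg i j hi hj h h').eq.symm
  ffc := hr.ff
  idem := hr.ee

/-- The elements `G_k` as units. -/
def GU (u : ℕ → Qˣ) : ℕ → Qˣ
  | 0 => u 0 * u 1
  | k + 1 => u (k + 2) * GU u k * u (k + 2)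

theorem GU_coe {n : ℕ} {g : ℕ → Q} {u : ℕ → Qˣ} (hu : ∀ i < n, (u i : Q) = g i) (k : ℕ)
    (hk : k + 2 ≤ n) : (GU u k : Q) = Gw g k := by
  induction k with
  | zero => simp [GU, Gw, hu 0 (by omega), hu 1 (by omega)]
  | succ k ih => simp [GU, Gw, hu (k + 2) (by omega), ih (by omega)]

/-- The subgroups. -/
def Gam (u : ℕ → Qˣ) (k : ℕ) : Subgroup Qˣ := Subgroup.closure (u '' {i | i < k + 2})

theorem u_mem_Gam (u : ℕ → Qˣ) (k i : ℕ) (hi : i < k + 2) : u i ∈ Gam u k :=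
  Subgroup.subset_closure ⟨i, hi, rfl⟩

theorem Gam_succ (u : ℕ → Qˣ) (k : ℕ) : Gam u (k + 1) = Gam u k ⊔ Subgroup.zpowers (u (k + 2)) := by
  unfold Gam
  rw [Subgroup.zpowers_eq_closure, ← Subgroup.closure_union]
  congr 1
  ext x
  simp only [Set.mem_image, Set.mem_ofPred_eq, Set.mem_union, Set.mem_singleton_iff]
  constructor
  · rintro ⟨i, hi, rfl⟩
    by_cases h : i < k + 2
    · exact Or.inl ⟨i, h, rfl⟩
    · right; congr 1; omega
  · rintro (⟨i, hi, rfl⟩ | rfl)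
    · exact ⟨i, by omega, rfl⟩
    · exact ⟨k + 2, by omega, rfl⟩

theorem GU_mem (u : ℕ → Qˣ) (k : ℕ) : GU u k ∈ Gam u k := by
  induction k with
  | zero => exact mul_mem (u_mem_Gam _ _ _ (by omega)) (u_mem_Gam _ _ _ (by omega))
  | succ k ih =>
    have h := u_mem_Gam u (k + 1) (k + 2) (by omega)
    have : Gam u k ≤ Gam u (k + 1) := by rw [Gam_succ]; exact le_sup_left
    exact mul_mem (mul_mem h (this ih)) h

variable {n : ℕ} {u : ℕ → Qˣ} {f : ℕ → Q}

theorem UR.GG (h : UR n u f) (k : ℕ) (hk : k + 2 ≤ n) : GU u k * GU u k = 1 := by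
  induction k with
  | zero =>
    have c := h.ugc 0 1 (by omega) (by omega) (by omega) (by unfold adjN; omega)
    calc u 0 * u 1 * (u 0 * u 1) = u 0 * (u 1 * u 0) * u 1 := by simp only [mul_assoc]
      _ = (u 0 * u 0) * (u 1 * u 1) := by rw [← c]; simp only [mul_assoc]
      _ = 1 := by rw [h.uu 0 (by omega), h.uu 1 (by omega), mul_one]
  | succ k ih =>
    have e := h.uu (k + 2) (by omega)
    calc u (k + 2) * GU u k * u (k + 2) * (u (k + 2) * GU u k * u (k + 2))
        = u (k + 2) * GU u k * (u (k + 2) * u (k + 2)) * GU u k * u (k + 2) := by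
          simp only [mul_assoc]
      _ = u (k + 2) * (GU u k * GU u k) * u (k + 2) := by rw [e, mul_one]; simp only [mul_assoc]
      _ = 1 := by rw [ih (by omega), mul_one, e]

/-- `Gam k` centralizes far nodes. -/
theorem UR.far (h : UR n u f) (k j : ℕ) (hj : k + 3 ≤ j) (hjn : j < n) :
    ∀ w ∈ Gam u k, w * u j = u j * w ∧ cj w (f j) = f j := by
  intro w hw
  induction hw using Subgroup.closure_induction with
  | mem x hx =>
    obtain ⟨i, hi, rfl⟩ := hx
    simp only [Set.mem_ofPred_eq] at hi
    exact ⟨h.ugc i j (by omega) hjn (by omega) (by unfold adjN; omega),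
      h.ufc j i hjn (by omega) (by omega) (by unfold adjN; omega)⟩
  | one => exact ⟨by simp, cj_one _⟩
  | mul x y hx hy ihx ihy =>
    exact ⟨by rw [mul_assoc, ihy.1, ← mul_assoc, ihx.1, mul_assoc], by rw [cj_mul, ihy.2, ihx.2]⟩
  | inv x hx ih =>
    refine ⟨?_, cj_self_inv ih.2⟩
    rw [inv_mul_eq_iff_eq_mul, ← mul_assoc, ih.1, mul_assoc, mul_inv_cancel, mul_one]

/-- The auxiliary conjugation identity. -/
theorem pc1 {a b H : Qˣ} {x y : Q} (bb : b * b = 1) (Ha : H * a = a * H)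
    (hx : cj b x = cj a y) : x = cj (b * a) y ∧ cj (b * H * b) x = cj (b * a) (cj H y) := by
  constructor
  · rw [cj_mul, ← hx, ← cj_mul, bb, cj_one]
  · rw [cj_mul, hx, ← cj_mul, ← cj_mul]
    congr 1
    rw [mul_assoc, Ha, mul_assoc]

theorem UR.cjb (h : UR n u f) (i j : ℕ) (hi : i < n) (hj : j < n) (hadj : adjN i j) :
    cj (u j) (u i : Q) = cj (u i) (u j : Q) ∧ cj (u j) (f i) = cj (u i) (f j) := by
  have ii : (u i)⁻¹ = u i := inv_eq_self_of_sq (h.uu i hi)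
  have jj : (u j)⁻¹ = u j := inv_eq_self_of_sq (h.uu j hj)
  constructor
  · unfold cj; rw [ii, jj]; exact_mod_cast (h.aba i j hi hj hadj).symm
  · rw [← h.cjf i j hi hj hadj, ← cj_mul, ← mul_assoc, h.uu i hi, one_mul]

/-- Commutations `PC`. -/
theorem UR.PC (h : UR n u f) (k : ℕ) (hk : k + 3 ≤ n) :
    ∀ x ∈ ({(u (k + 2) : Q), f (k + 2)} : Set Q), ∀ y ∈ ({(u (k + 2) : Q), f (k + 2)} : Set Q),
      Commute x (cj (GU u k) y) := by
  induction k with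
  | zero =>
    have c0 := h.cjb 2 0 (by omega) (by omega) (by unfold adjN; omega)
    have c1 := h.cjb 2 1 (by omega) (by omega) (by unfold adjN; omega)
    have b0 := h.uu 0 (by omega)
    have e1 : ∀ {x y : Q}, cj (u 0) x = cj (u 2) y → x = cj (u 0 * u 2) y := by
      intro x y hx; rw [cj_mul, ← hx, ← cj_mul, b0, cj_one]
    have e2 : ∀ {x y : Q}, cj (u 1) x = cj (u 2) y → cj (GU u 0) x = cj (u 0 * u 2) y := by
      intro x y hx; rw [GU, cj_mul, hx, ← cj_mul]
    have key : ∀ x ∈ ({(u 0 : Q), f 0} : Set Q), ∀ y ∈ ({(u 1 : Q), f 1} : Set Q), Commute x y := by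
      have na : ¬ adjN 0 1 := by unfold adjN; omega
      have na' : ¬ adjN 1 0 := by unfold adjN; omega
      rintro x (rfl | rfl) y (rfl | rfl)
      · exact congrArg Units.val (h.ugc 0 1 (by omega) (by omega) (by omega) na)
      · exact (cj_eq_iff _ _ _).1 (h.ufc 1 0 (by omega) (by omega) (by omega) na')
      · exact ((cj_eq_iff _ _ _).1 (h.ufc 0 1 (by omega) (by omega) (by omega) na)).symm
      · exact h.ffc 0 1 (by omega) (by omega) (by omega) na
    have X : ∀ x ∈ ({(u 2 : Q), f 2} : Set Q), ∃ y ∈ ({(u 0 : Q), f 0} : Set Q),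
        x = cj (u 0 * u 2) y := by
      rintro x (rfl | rfl)
      · exact ⟨_, by simp, e1 c0.1⟩
      · exact ⟨_, by simp, e1 c0.2⟩
    have Y : ∀ x ∈ ({(u 2 : Q), f 2} : Set Q), ∃ y ∈ ({(u 1 : Q), f 1} : Set Q),
        cj (GU u 0) x = cj (u 0 * u 2) y := by
      rintro x (rfl | rfl)
      · exact ⟨_, by simp, e2 c1.1⟩
      · exact ⟨_, by simp, e2 c1.2⟩
    intro x hx y hy
    obtain ⟨x', hx', rfl⟩ := X x hx
    obtain ⟨y', hy', hyy⟩ := Y y hy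
    rw [hyy, cj_commute]
    exact key x' hx' y' hy'
  | succ k ih =>
    have ih := ih (by omega)
    have c := h.cjb (k + 3) (k + 2) (by omega) (by omega) (by unfold adjN; omega)
    have Ha := (h.far k (k + 3) (by omega) (by omega) _ (GU_mem u k)).1
    have b0 := h.uu (k + 2) (by omega)
    have X : ∀ x ∈ ({(u (k + 3) : Q), f (k + 3)} : Set Q),
        ∃ y ∈ ({(u (k + 2) : Q), f (k + 2)} : Set Q),
        x = cj (u (k + 2) * u (k + 3)) y ∧
          cj (GU u (k + 1)) x = cj (u (k + 2) * u (k + 3)) (cj (GU u k) y) := by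
      rintro x (rfl | rfl)
      · exact ⟨_, by simp, pc1 b0 Ha c.1⟩
      · exact ⟨_, by simp, pc1 b0 Ha c.2⟩
    intro x hx y hy
    obtain ⟨x', hx', hxx, -⟩ := X x hx
    obtain ⟨y', hy', -, hyy⟩ := X y hy
    rw [hyy, hxx, cj_commute]
    exact ih x' hx' y' hy'

/-- Twist. -/
theorem BRel.twU {g : ℕ → Q} (hr : BRel n (0 : F) 1 1 0 0 g f) (hu : ∀ i < n, (u i : Q) = g i)
    (k : ℕ) (hk : k + 3 ≤ n) : ∀ p ∈ Gam u k, ∃ p' ∈ Gam u k, p * GU u (k + 1) = GU u (k + 1) * p' := by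
  intro p hp
  induction hp using Subgroup.closure_induction with
  | mem x hx =>
    obtain ⟨i, hi, rfl⟩ := hx
    simp only [Set.mem_ofPred_eq] at hi
    have hs : sw i < k + 2 := by unfold sw; split_ifs <;> omega
    refine ⟨u (sw i), u_mem_Gam _ _ _ hs, ?_⟩
    have hss : sw (sw i) = i := by grind [sw]
    have := (hr.twist k hk (sw i) hs).1
    rw [hss] at this
    apply Units.ext
    rw [Units.val_mul, Units.val_mul, GU_coe hu _ (by omega), hu _ (by omega), hu _ (by omega), this]
  | one => exact ⟨1, one_mem _, by simp⟩
  | mul x y hx hy ihx ihy =>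
    obtain ⟨x', hx', ex⟩ := ihx
    obtain ⟨y', hy', ey⟩ := ihy
    exact ⟨x' * y', mul_mem hx' hy', by rw [mul_assoc, ey, ← mul_assoc, ex, mul_assoc]⟩
  | inv x hx ih =>
    obtain ⟨x', hx', ex⟩ := ih
    refine ⟨x'⁻¹, inv_mem hx', ?_⟩
    rw [inv_mul_eq_iff_eq_mul, ← mul_assoc, ex, mul_assoc, mul_inv_cancel, mul_one]

/-- The small subgroup at each level. -/
def Us (u : ℕ → Qˣ) : ℕ → Subgroup Qˣ
  | 0 => ⊥
  | k + 1 => Gam u k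

/-- The neighbours at each level. -/
def Nbs (u : ℕ → Qˣ) : ℕ → Set Qˣ
  | 0 => {u 0, u 1}
  | k + 1 => {u (k + 2)}

theorem Nbs_spec (u : ℕ → Qˣ) (k : ℕ) : ∀ b ∈ Nbs u k, ∃ i < k + 2, adjN (k + 2) i ∧ b = u i := by
  cases k with
  | zero =>
    rintro b (rfl | rfl)
    · exact ⟨0, by omega, by unfold adjN; omega, rfl⟩
    · exact ⟨1, by omega, by unfold adjN; omega, rfl⟩
  | succ k =>
    rintro b rfl
    exact ⟨k + 2, by omega, by unfold adjN; omega, rfl⟩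

theorem UR.Gam0 (h : UR n u f) (hn : 2 ≤ n) (p : Qˣ) (hp : p ∈ Gam u 0) :
    p = 1 ∨ p = u 0 ∨ p = u 1 ∨ p = u 0 * u 1 := by
  have c := h.ugc 0 1 (by omega) (by omega) (by omega) (by unfold adjN; omega)
  have a0 := h.uu 0 (by omega)
  have a1 := h.uu 1 (by omega)
  have key : ∀ i < 2, ∀ p, (p = 1 ∨ p = u 0 ∨ p = u 1 ∨ p = u 0 * u 1) →
      (u i * p = 1 ∨ u i * p = u 0 ∨ u i * p = u 1 ∨ u i * p = u 0 * u 1) := by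
    intro i hi p hp
    obtain rfl | rfl : i = 0 ∨ i = 1 := by omega
    · obtain rfl | rfl | rfl | rfl := hp
      · simp
      · simp [a0]
      · simp
      · simp [← mul_assoc, a0]
    · obtain rfl | rfl | rfl | rfl := hp
      · simp
      · simp [c]
      · simp [a1]
      · right; left; rw [← mul_assoc, ← c, mul_assoc, a1, mul_one]
  induction hp using Subgroup.closure_induction_left with
  | one => simp
  | mul_left x hx y hy ih =>
    obtain ⟨i, hi, rfl⟩ := hx
    exact key i hi y ih
  | inv_mul_cancel x hx y hy ih =>
    obtain ⟨i, hi, rfl⟩ := hx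
    simp only [Set.mem_ofPred_eq, zero_add] at hi
    rw [inv_eq_self_of_sq (h.uu i (by omega))]
    exact key i hi y ih

theorem BRel.lev_of {g : ℕ → Q} (hr : BRel n (0 : F) 1 1 0 0 g f) (hu : ∀ i < n, (u i : Q) = g i)
    (k : ℕ) (hk : k + 3 ≤ n)
    (Ua : ∀ w ∈ Us u k, w * u (k + 2) = u (k + 2) * w)
    (Ue : ∀ w ∈ Us u k, cj w (f (k + 2)) = f (k + 2))
    (UΓ : Us u k ≤ Gam u k)
    (dec : ∀ p ∈ Gam u k, ∃ w ∈ Us u k, ∃ y, (y = 1 ∨ y ∈ Nbs u k ∨ y = GU u k) ∧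
      ∃ w' ∈ Us u k, p = w * y * w')
    (bG : ∀ b ∈ Nbs u k, ∃ H ∈ Gam u k, ∃ b' ∈ Nbs u k, H * u (k + 2) = u (k + 2) * H ∧
      cj H (f (k + 2)) = f (k + 2) ∧ b * GU u k = H * b')
    (tw : ∀ w ∈ Us u k, ∃ w' ∈ Us u k, w * GU u k = GU u k * w') :
    Lev (Us u k) (Gam u k) (Nbs u k) (GU u k) (u (k + 2)) (f (k + 2)) := by
  have h := hr.UR hu
  have pc := h.PC k hk
  have GG := h.GG k (by omega)
  have Gi : (GU u k)⁻¹ = GU u k := inv_eq_self_of_sq GG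
  refine ⟨Ua, Ue, UΓ, dec, ?_, GU_mem u k, ?_, h.uu _ (by omega), GG, ?_, ?_, h.uf _ (by omega), bG,
    tw, hr.twU hu k hk, ?_, ?_, pc _ (by simp) _ (by simp)⟩
  · intro b hb
    obtain ⟨i, hi, ha, rfl⟩ := Nbs_spec u k b hb
    exact u_mem_Gam u k i hi
  · intro b hb
    obtain ⟨i, hi, ha, rfl⟩ := Nbs_spec u k b hb
    exact h.uu i (by omega)
  · intro b hb
    obtain ⟨i, hi, ha, rfl⟩ := Nbs_spec u k b hb
    exact h.aba _ i (by omega) (by omega) ha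
  · intro b hb
    obtain ⟨i, hi, ha, rfl⟩ := Nbs_spec u k b hb
    exact h.fgf _ i (by omega) (by omega) ha
  · have := pc (u (k + 2)) (by simp) (u (k + 2)) (by simp)
    unfold cj at this
    rw [Gi] at this
    apply Units.ext
    simpa using this.eq
  · have := pc (u (k + 2)) (by simp) (f (k + 2)) (by simp)
    exact cj_self_of_commute this

theorem BRel.lev {g : ℕ → Q} (hr : BRel n (0 : F) 1 1 0 0 g f) (hu : ∀ i < n, (u i : Q) = g i)
    (k : ℕ) (hk : k + 3 ≤ n) :
    Lev (Us u k) (Gam u k) (Nbs u k) (GU u k) (u (k + 2)) (f (k + 2)) := by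
  have h := hr.UR hu
  induction k with
  | zero =>
    have c := h.ugc 0 1 (by omega) (by omega) (by omega) (by unfold adjN; omega)
    have a0 := h.uu 0 (by omega)
    have a1 := h.uu 1 (by omega)
    refine hr.lev_of hu 0 hk ?_ ?_ bot_le ?_ ?_ ?_
    · rintro w hw; obtain rfl := Subgroup.mem_bot.1 hw; simp
    · rintro w hw; obtain rfl := Subgroup.mem_bot.1 hw; exact cj_one _
    · intro p hp
      refine ⟨1, one_mem _, p, ?_, 1, one_mem _, by simp⟩
      obtain hp | hp | hp | hp := h.Gam0 (by omega) p hp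
      · exact Or.inl hp
      · exact Or.inr (Or.inl (Or.inl hp))
      · exact Or.inr (Or.inl (Or.inr hp))
      · exact Or.inr (Or.inr hp)
    · rintro b (rfl | rfl)
      · exact ⟨1, one_mem _, u 1, Or.inr rfl, by simp, cj_one _, by
          rw [GU, ← mul_assoc, a0]⟩
      · exact ⟨1, one_mem _, u 0, Or.inl rfl, by simp, cj_one _, by
          rw [GU, ← mul_assoc, ← c, mul_assoc, a1, mul_one, one_mul]⟩
    · rintro w hw; obtain rfl := Subgroup.mem_bot.1 hw
      exact ⟨1, one_mem _, by simp⟩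
  | succ k ih =>
    have ih := ih (by omega)
    have hfar := h.far k (k + 3) (by omega) (by omega)
    have hle : Gam u k ≤ Gam u (k + 1) := by rw [Gam_succ]; exact le_sup_left
    refine hr.lev_of hu (k + 1) hk (fun w hw => (hfar w hw).1) (fun w hw => (hfar w hw).2)
      hle ?_ ?_ (hr.twU hu k (by omega))
    · intro p hp
      rw [Gam_succ] at hp
      exact ih.decomp p hp
    · rintro b rfl
      refine ⟨GU u k, hle (GU_mem u k), _, rfl, (hfar _ (GU_mem u k)).1, (hfar _ (GU_mem u k)).2, ?_⟩
      rw [GU, ← mul_assoc, ← mul_assoc, h.uu (k + 2) (by omega), one_mul]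

end
end BMWProof

namespace BMWProof
section
variable {F Q : Type*} [Field F] [Ring Q] [Algebra F Q]
variable {n : ℕ} {u : ℕ → Qˣ} {f : ℕ → Q}

theorem commute_of_zero {x y : Q} (h1 : x * y = 0) (h2 : y * x = 0) : Commute x y :=
  h1.trans h2.symm

/-- The key orthogonality. -/
theorem orth {a b H : Qˣ} {e f z : Q} (bb : b * b = 1) (aa : a * a = 1) (HH : H * H = 1)
    (Ha : H * a = a * H) (He : cj H e = e) (cbe : cj b e = cj a f) (fe : f * e = 0)
    (hz : f * H * b * H = z * f) : Commute e (cj (b * H) f) := by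
  have bi : b⁻¹ = b := inv_eq_self_of_sq bb
  have ai : a⁻¹ = a := inv_eq_self_of_sq aa
  have Hi : H⁻¹ = H := inv_eq_self_of_sq HH
  have bb' : (b : Q) * b = 1 := by rw [← Units.val_mul, bb, Units.val_one]
  have aa' : (a : Q) * a = 1 := by rw [← Units.val_mul, aa, Units.val_one]
  have HH' : (H : Q) * H = 1 := by rw [← Units.val_mul, HH, Units.val_one]
  have Ha' : (H : Q) * a = a * H := by exact_mod_cast congrArg Units.val Ha
  have He' : (H : Q) * e = e * H := (cj_eq_iff _ _ _).1 He
  have cbe' : (b : Q) * e * b = a * f * a := by unfold cj at cbe; rwa [bi, ai] at cbe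
  have k1 : f * H * b = z * f * H := by
    calc f * H * b = f * H * b * (H * H) := by rw [HH', mul_one]
      _ = f * H * b * H * H := by simp only [mul_assoc]
      _ = _ := by rw [hz]
  have k2 : f * H * b * e = 0 := by
    rw [k1, mul_assoc, He', mul_assoc, ← mul_assoc f, fe, zero_mul, mul_zero]
  have k3 : (a : Q) * f = b * e * b * a := by
    rw [cbe', mul_assoc, aa', mul_one]
  have k4 : e * b = b * a * f * a := by
    calc e * b = (b * b) * e * b := by rw [bb', one_mul]
      _ = b * (b * e * b) := by simp only [mul_assoc]
      _ = _ := by rw [cbe']; simp only [mul_assoc]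
  have k5 : e * b * H * f = 0 := by
    calc e * b * H * f = b * a * f * (a * H) * f := by rw [k4]; simp only [mul_assoc]
      _ = b * a * f * H * (a * f) := by rw [← Ha']; simp only [mul_assoc]
      _ = b * a * (f * H * b * e) * b * a := by rw [k3]; simp only [mul_assoc]
      _ = 0 := by rw [k2]; simp
  have ex : cj (b * H) f = b * H * f * H * b := by
    rw [cj_mul]; unfold cj; rw [bi, Hi]; simp only [mul_assoc]
  apply commute_of_zero
  · calc e * cj (b * H) f = (e * b * H * f) * H * b := by rw [ex]; simp only [mul_assoc]
      _ = 0 := by rw [k5]; simp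
  · calc cj (b * H) f * e = b * H * (f * H * b * e) := by rw [ex]; simp only [mul_assoc]
      _ = 0 := by rw [k2]; simp

theorem UR.ab_e (h : UR n u f) (i j : ℕ) (hi : i < n) (hj : j < n) (hadj : adjN i j) :
    Commute (f i) (f j) :=
  commute_of_zero (h.ff0 i j hi hj hadj) (h.ff0 j i hj hi (adjN_symm hadj))

theorem BRel.hfin {g : ℕ → Q} (hr : BRel n (0 : F) 1 1 0 0 g f) (hu : ∀ i < n, (u i : Q) = g i)
    (k : ℕ) (hk : k + 3 ≤ n) :
    ∀ b ∈ Nbs u k, ∀ b' ∈ Nbs u k, ∀ z ∈ Us u k,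
      Commute (f (k + 2)) (cj (b * u (k + 2) * z * b') (f (k + 2))) := by
  have h := hr.UR hu
  cases k with
  | zero =>
    have a0 : adjN 2 0 := by unfold adjN; omega
    have a1 : adjN 2 1 := by unfold adjN; omega
    have na : ¬ adjN 0 1 := by unfold adjN; omega
    have na' : ¬ adjN 1 0 := by unfold adjN; omega
    have e0 := h.cjf 2 0 (by omega) (by omega) a0
    have e1 := h.cjf 2 1 (by omega) (by omega) a1
    have c0 := h.ab_e 2 0 (by omega) (by omega) a0
    have c1 := h.ab_e 2 1 (by omega) (by omega) a1
    intro b hb b' hb' z hz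
    obtain rfl := Subgroup.mem_bot.1 hz
    rw [mul_one, mul_assoc, cj_mul]
    obtain rfl | rfl := hb <;> obtain rfl | rfl := hb' <;> simp only [zero_add]
    · rw [e0, h.uf 0 (by omega)]; exact c0
    · rw [e1, h.ufc 1 0 (by omega) (by omega) (by omega) na']; exact c1
    · rw [e0, h.ufc 0 1 (by omega) (by omega) (by omega) na]; exact c0
    · rw [e1, h.uf 1 (by omega)]; exact c1
  | succ k =>
    rintro b rfl b' rfl z hz
    have hfar := h.far k (k + 3) (by omega) (by omega)
    have lev := hr.lev hu k (by omega)
    have ha : adjN (k + 3) (k + 2) := by unfold adjN; omega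
    have e0 := h.cjf (k + 3) (k + 2) (by omega) (by omega) ha
    have r1 : cj (u (k + 2) * u (k + 3) * z * u (k + 2)) (f (k + 3)) =
        cj (u (k + 2) * z) (f (k + 2)) := by
      rw [← e0, ← cj_mul]
      congr 1
      rw [mul_assoc (u (k + 2)), ← (hfar z hz).1]; simp only [mul_assoc]
    change Commute (f (k + 3)) (cj (u (k + 2) * u (k + 3) * z * u (k + 2)) (f (k + 3)))
    rw [r1]
    obtain ⟨w, hw, y, hy, w', hw', rfl⟩ := lev.dec z hz
    have r2 : cj (u (k + 2) * (w * y * w')) (f (k + 2)) = cj w (cj (u (k + 2) * y) (f (k + 2))) := by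
      rw [← mul_assoc, cj_mul, lev.Ue w' hw', ← cj_mul, ← mul_assoc, ← lev.Ua w hw, mul_assoc]
    have hwe := (hfar w (lev.UΓ hw)).2
    rw [r2]
    conv_lhs => rw [← hwe]
    rw [cj_commute]
    obtain rfl | hc | rfl := hy
    · rw [mul_one, h.uf _ (by omega)]
      exact h.ab_e _ _ (by omega) (by omega) ha
    · obtain ⟨i, hi, hai, rfl⟩ := Nbs_spec u k y hc
      rw [h.cjf _ i (by omega) (by omega) hai]
      exact h.ffc _ _ (by omega) (by omega) (by omega) (by unfold adjN; omega)
    · obtain ⟨z, hz⟩ := hr.exists_z k (by omega)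
      rw [← GU_coe hu _ (by omega), ← hu _ (by omega)] at hz
      have hG := hfar _ (GU_mem u k)
      exact orth (h.uu _ (by omega)) (h.uu _ (by omega)) (h.GG k (by omega)) hG.1 hG.2
        (h.cjb _ _ (by omega) (by omega) ha).2 (h.ff0 _ _ (by omega) (by omega) (adjN_symm ha)) hz

theorem BRel.Gam_finite {g : ℕ → Q} (hr : BRel n (0 : F) 1 1 0 0 g f) (hu : ∀ i < n, (u i : Q) = g i)
    (k : ℕ) (hk : k + 2 ≤ n) : (Gam u k : Set Qˣ).Finite := by
  have h := hr.UR hu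
  induction k with
  | zero =>
    refine (Set.toFinite {1, u 0, u 1, u 0 * u 1}).subset fun p hp => ?_
    simpa using h.Gam0 hk p hp
  | succ k ih => rw [Gam_succ]; exact (hr.lev hu k (by omega)).finite (ih (by omega))

theorem UR.conj (h : UR n u f) (k i : ℕ) (hk : k + 3 = n) (hi : i < n) :
    ∃ w ∈ Gam u (k + 1), f i = cj w (f (k + 2)) := by
  have step : ∀ j i, j < n → i < n → adjN j i → (∃ w ∈ Gam u (k + 1), f j = cj w (f (k + 2))) →
      ∃ w ∈ Gam u (k + 1), f i = cj w (f (k + 2)) := by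
    rintro j i hj hi ha ⟨w, hw, e⟩
    exact ⟨u j * u i * w, mul_mem (mul_mem (u_mem_Gam _ _ _ (by omega)) (u_mem_Gam _ _ _ (by omega))) hw,
      by rw [cj_mul, ← e, h.cjf j i hj hi ha]⟩
  have main : ∀ d i, 1 ≤ i → i + d = k + 2 → ∃ w ∈ Gam u (k + 1), f i = cj w (f (k + 2)) := by
    intro d
    induction d with
    | zero => rintro i hi1 rfl; exact ⟨1, one_mem _, (cj_one _).symm⟩
    | succ d ih =>
      intro i hi1 hid
      exact step (i + 1) i (by omega) (by omega) (by unfold adjN; omega) (ih (i + 1) (by omega) (by omega))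
  by_cases hi0 : i = 0
  · subst hi0
    exact step 2 0 (by omega) (by omega) (by unfold adjN; omega) (main k 2 (by omega) (by omega))
  · exact main (k + 2 - i) i (by omega) (by omega)

theorem BRel.comm {g : ℕ → Q} (hr : BRel n (0 : F) 1 1 0 0 g f) (hu : ∀ i < n, (u i : Q) = g i)
    (k : ℕ) (hk : k + 2 = n) (i j : ℕ) (hi : i < n) (hj : j < n) (w : Qˣ) (hw : w ∈ Gam u k) :
    Commute (f i) (cj w (f j)) := by
  have h := hr.UR hu
  cases k with
  | zero =>
    have na : ∀ i j, i < 2 → j < 2 → ¬ adjN i j := by unfold adjN; omega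
    have : cj w (f j) = f j := by
      have : ∀ i < 2, cj (u i) (f j) = f j := by
        intro i hi
        by_cases hij : i = j
        · subst hij; exact h.uf _ (by omega)
        · exact h.ufc j i hj (by omega) (by omega) (na _ _ (by omega) (by omega))
      obtain rfl | rfl | rfl | rfl := h.Gam0 (by omega) w hw
      · exact cj_one _
      · exact this 0 (by omega)
      · exact this 1 (by omega)
      · rw [cj_mul, this 1 (by omega), this 0 (by omega)]
    rw [this]
    by_cases hij : i = j
    · subst hij; exact Commute.refl _
    · exact h.ffc i j hi hj hij (na _ _ (by omega) (by omega))
  | succ k =>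
    obtain ⟨v, hv, ev⟩ := h.conj k i (by omega) hi
    obtain ⟨v', hv', ev'⟩ := h.conj k j (by omega) hj
    rw [ev, ev', ← cj_mul, ← cj_commute v⁻¹, cj_inv_cj, ← cj_mul]
    refine (hr.lev hu k (by omega)).commute (hr.hfin hu k (by omega)) _ ?_
    rw [← Gam_succ]
    exact mul_mem (inv_mem hv) (mul_mem hw hv')

end
end BMWProof

namespace BMWProof

theorem finite_sup {G : Type*} [Group G] (H N : Subgroup G) (hHN : H ≤ Subgroup.normalizer N)
    (hH : (H : Set G).Finite) (hN : (N : Set G).Finite) : ((H ⊔ N : Subgroup G) : Set G).Finite := by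
  rw [Subgroup.coe_mul_of_left_le_normalizer_right H N hHN]
  exact hH.mul hN

theorem finite_closure_invol {G : Type*} [Group G] (S : Set G) (hS : S.Finite)
    (h2 : ∀ s ∈ S, s * s = 1) (hc : ∀ s ∈ S, ∀ t ∈ S, s * t = t * s) :
    (Subgroup.closure S : Set G).Finite := by
  induction S, hS using Set.Finite.induction_on with
  | empty => simp
  | @insert a T ha hT ih =>
    have ih := ih (fun s hs => h2 s (Or.inr hs)) (fun s hs t ht => hc s (Or.inr hs) t (Or.inr ht))
    rw [Set.insert_eq, Subgroup.closure_union]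
    refine finite_sup _ _ ?_ ?_ ih
    · rw [Subgroup.closure_le]
      rintro x rfl
      refine Subgroup.normalizer_le_normalizer_closure _ ?_
      refine Subgroup.centralizer_le_normalizer T ?_
      rw [Subgroup.mem_centralizer_iff]
      intro t ht
      exact hc t (Or.inr ht) x (Or.inl rfl)
    · rw [← Subgroup.zpowers_eq_closure]
      have : IsOfFinOrder a := isOfFinOrder_iff_pow_eq_one.2
        ⟨2, by norm_num, by rw [pow_two]; exact h2 a (Or.inl rfl)⟩
      exact this.finite_zpowers

section
variable {F Q : Type*} [Field F] [CharZero F] [Ring Q] [Algebra F Q]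

/-- An algebra generated by a finite group of units is semisimple. -/
theorem semisimple_of_finite_group (Γ : Subgroup Qˣ) (hΓ : (Γ : Set Qˣ).Finite)
    (hgen : ∀ A : Subalgebra F Q, (∀ w ∈ Γ, (w : Q) ∈ A) → A = ⊤) : IsSemisimpleRing Q := by
  have : Finite Γ := hΓ.to_subtype
  let φ : Γ →* Q := (Units.coeHom Q).comp Γ.subtype
  let Φ : MonoidAlgebra F Γ →ₐ[F] Q := MonoidAlgebra.lift F Q Γ φ
  have hΦ : Φ.range = ⊤ := hgen _ fun w hw => ⟨MonoidAlgebra.of F Γ ⟨w, hw⟩, by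
    simp [Φ, φ]⟩
  have : NeZero (Nat.card Γ : F) := ⟨by
    rw [Nat.cast_ne_zero]; exact Nat.card_pos.ne'⟩
  exact RingHom.isSemisimpleRing_of_surjective Φ.toRingHom (AlgHom.range_eq_top _ |>.1 hΦ)

theorem one_sub_two_sq (x : Q) (h : x * x = x) : (1 - 2 * x) * (1 - 2 * x) = 1 := by
  have : (1 - 2 * x) * (1 - 2 * x) = 1 - 4 * x + 4 * (x * x) := by noncomm_ring
  rw [this, h]; noncomm_ring

/-- The involution attached to an idempotent. -/
def invo (x : Q) (h : x * x = x) : Qˣ := ⟨1 - 2 * x, 1 - 2 * x, one_sub_two_sq x h, one_sub_two_sq x h⟩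

theorem BRel.semisimple {n : ℕ} (hn : 2 ≤ n) {g f : ℕ → Q} (hr : BRel n (0 : F) 1 1 0 0 g f)
    (hgen : Algebra.adjoin F {x | ∃ i < n, x = g i ∨ x = f i} = ⊤) : IsSemisimpleRing Q := by
  classical
  have hgg : ∀ i < n, g i * g i = 1 := fun i hi => by simpa using hr.aa i hi
  let u : ℕ → Qˣ := fun i => if hi : i < n then ⟨g i, g i, hgg i hi, hgg i hi⟩ else 1
  have hu : ∀ i < n, (u i : Q) = g i := fun i hi => by simp [u, hi]
  obtain ⟨k, rfl⟩ : ∃ k, n = k + 2 := ⟨n - 2, by omega⟩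
  have hfin := hr.Gam_finite hu k le_rfl
  have hcomm := hr.comm hu k rfl
  set Γ := Gam u k with hΓ
  have hid : ∀ w : Qˣ, ∀ i < k + 2, cj w (f i) * cj w (f i) = cj w (f i) := fun w i hi => by
    rw [← cj_mul', hr.ee i hi]
  have hcc : ∀ v ∈ Γ, ∀ w ∈ Γ, ∀ i < k + 2, ∀ j < k + 2, Commute (cj v (f i)) (cj w (f j)) := by
    intro v hv w hw i hi j hj
    rw [← cj_commute v⁻¹, cj_inv_cj, ← cj_mul]
    exact hcomm i j hi hj _ (mul_mem (inv_mem hv) hw)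
  let S : Set Qˣ := {s | ∃ w ∈ Γ, ∃ i < k + 2, (s : Q) = 1 - 2 * cj w (f i)}
  have hSf : S.Finite := by
    have : ((fun p : Qˣ × ℕ => 1 - 2 * cj p.1 (f p.2)) '' ((Γ : Set Qˣ) ×ˢ {i | i < k + 2})).Finite :=
      (hfin.prod (Set.finite_lt_nat _)).image _
    refine Set.Finite.of_finite_image (f := Units.val) (this.subset ?_) Units.val_injective.injOn
    rintro _ ⟨s, ⟨w, hw, i, hi, e⟩, rfl⟩
    exact ⟨(w, i), ⟨hw, hi⟩, e.symm⟩
  have hN : (Subgroup.closure S : Set Qˣ).Finite := by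
    refine finite_closure_invol S hSf ?_ ?_
    · rintro s ⟨w, hw, i, hi, e⟩
      apply Units.ext
      rw [Units.val_mul, e, one_sub_two_sq _ (hid w i hi), Units.val_one]
    · rintro s ⟨w, hw, i, hi, e⟩ s' ⟨w', hw', i', hi', e'⟩
      apply Units.ext
      rw [Units.val_mul, Units.val_mul, e, e']
      have c : Commute (cj w (f i)) (cj w' (f i')) := hcc w hw w' hw' i hi i' hi'
      have h2 : ∀ x : Q, Commute (2 : Q) x := fun x => by exact Nat.cast_commute 2 x
      exact (((Commute.one_left _).sub_left ((Commute.mul_left (h2 _)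
        ((Commute.one_right _).sub_right ((h2 _).symm.mul_right c))))))
  have hnorm : Γ ≤ Subgroup.normalizer (Subgroup.closure S : Set Qˣ) := by
    rw [Subgroup.le_normalizer_closure_iff]
    rintro v hv s ⟨w, hw, i, hi, e⟩
    refine Subgroup.subset_closure ⟨v * w, mul_mem hv hw, i, hi, ?_⟩
    rw [Units.val_mul, Units.val_mul, e, cj_mul]
    generalize cj w (f i) = x
    unfold cj
    rw [mul_sub, sub_mul, mul_one, Units.mul_inv, two_mul, two_mul, mul_add, add_mul]
  refine semisimple_of_finite_group (F := F) _ (finite_sup _ _ hnorm hfin hN) ?_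
  intro A hA
  rw [← top_le_iff, ← hgen, Algebra.adjoin_le_iff]
  rintro x ⟨i, hi, rfl | rfl⟩
  · rw [← hu i hi]
    exact hA _ (Subgroup.mem_sup_left (u_mem_Gam u k i hi))
  · have h1 : ((invo (f i) (hr.ee i hi) : Qˣ) : Q) ∈ A :=
      hA _ (Subgroup.mem_sup_right (Subgroup.subset_closure
        ⟨1, one_mem _, i, hi, by rw [cj_one]; rfl⟩))
    have h2 : f i = (2⁻¹ : F) • (1 - (1 - 2 * f i)) := by
      rw [sub_sub_cancel, two_mul, smul_add, ← add_smul]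
      norm_num
    rw [h2]
    exact A.smul_mem (A.sub_mem A.one_mem h1) _
end
end BMWProof

namespace BMWProof
open scoped TensorProduct Pointwise

/-- Transport of the relations along a ring homomorphism. -/
theorem BRel.map {V V' Λ Λ' : Type*} [CommRing V] [CommRing V'] [Ring Λ] [Ring Λ'] [Algebra V Λ]
    [Algebra V' Λ'] {n : ℕ} {t l li m μ : V} {t' l' li' m' μ' : V'} {g f : ℕ → Λ}
    (hr : BRel n t l li m μ g f) (φ : Λ →+* Λ')
    (ht : ∀ x, φ (t • x) = t' • φ x) (hl : ∀ x, φ (l • x) = l' • φ x)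
    (hli : ∀ x, φ (li • x) = li' • φ x) (hm : ∀ x, φ (m • x) = m' • φ x)
    (hμ : ∀ x, φ (μ • x) = μ' • φ x) :
    BRel n t' l' li' m' μ' (fun i => φ (g i)) (fun i => φ (f i)) where
  pair i j hi hj h := by
    have p := hr.pair i j hi hj h
    constructor
    · simpa using congrArg φ p.aba
    · simpa using congrArg φ p.abe
    · simpa using congrArg φ p.baf
    · simpa [mul_smul, ht, hl] using congrArg φ p.ebe
    · simpa [mul_smul, ht, hl] using congrArg φ p.faf
    · simpa [ht] using congrArg φ p.ef
    · simpa [ht] using congrArg φ p.fe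
    · simpa [mul_smul, hm, hμ, hli] using congrArg φ p.aa
    · simpa [hli] using congrArg φ p.ae
    · simpa [hli] using congrArg φ p.ea
    · simpa using congrArg φ p.ee
    · simpa [mul_smul, hm, hμ, hli] using congrArg φ p.bb
    · simpa [hli] using congrArg φ p.bf
    · simpa [hli] using congrArg φ p.fb
    · simpa using congrArg φ p.ff
  gg i j hi hj h h' := (hr.gg i j hi hj h h').map φ
  fg i j hi hj h h' := (hr.fg i j hi hj h h').map φ
  ff i j hi hj h h' := (hr.ff i j hi hj h h').map φ
  aa i hi := by simpa [mul_smul, hm, hμ, hli] using congrArg φ (hr.aa i hi)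
  ae i hi := by simpa [hli] using congrArg φ (hr.ae i hi)
  ea i hi := by simpa [hli] using congrArg φ (hr.ea i hi)
  ee i hi := by simpa using congrArg φ (hr.ee i hi)

/-- The Jacobson radical of an Artinian ring is nilpotent, as a set. -/
theorem jac_nilp (A : Type*) [Ring A] [IsArtinianRing A] :
    ∃ d, ∀ x ∈ ((Ring.jacobson A : Ideal A) : Set A) ^ (d + 1), x = 0 := by
  obtain ⟨d, hd⟩ := IsArtinianRing.isNilpotent_jacobson_bot (R := A)
  rw [Ideal.jacobson_bot] at hd
  generalize Ring.jacobson A = J at hd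
  have key : ∀ k, ∀ x ∈ (J : Set A) ^ (k + 1), x ∈ J ^ (k + 1) := by
    intro k
    induction k with
    | zero => intro x hx; simpa [Submodule.pow_one] using hx
    | succ k ih =>
      intro x hx
      rw [pow_succ'] at hx
      obtain ⟨a, ha, b, hb, rfl⟩ := hx
      rw [Submodule.pow_succ' _ (by omega)]
      exact Ideal.mul_mem_mul ha (ih b hb)
  cases d with
  | zero =>
    refine ⟨0, fun x _ => ?_⟩
    have h1 : (1 : A) ∈ J ^ 0 := by
      rw [Submodule.pow_zero]; exact Submodule.one_le.1 le_rfl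
    rw [hd] at h1
    have h2 : (1 : A) = 0 := by simpa using h1
    rw [← mul_one x, h2, mul_zero]
  | succ d =>
    refine ⟨d, fun x hx => ?_⟩
    have := key d x hx
    rw [hd] at this
    simpa using this

/-- A left ideal of nilpotents vanishes in a semisimple ring. -/
theorem eq_zero_of_nil {Q : Type*} [Ring Q] [IsSemisimpleRing Q] (y : Q)
    (h : ∀ q : Q, IsNilpotent (q * y)) : y = 0 := by
  have : y ∈ Ring.jacobson Q := by
    rw [← Ideal.jacobson_bot, Ideal.mem_jacobson_iff]
    intro q
    obtain ⟨w, hw⟩ := (h q).isUnit_one_add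
    refine ⟨(w⁻¹ : Qˣ), ?_⟩
    have : (w⁻¹ : Qˣ) * (1 + q * y) = (1 : Q) := by rw [← hw]; simp
    rw [mul_add, mul_one] at this
    rw [mul_assoc, add_comm, this, sub_self]
    exact Submodule.zero_mem _
  rw [IsSemisimpleRing.jacobson_eq_bot] at this
  simpa using this

section
variable {F V Λ : Type*} [Field F] [CharZero F] [CommRing V] [Ring Λ] [Algebra F V] [Algebra V Λ]

/-- The reduction of `Λ` modulo `x` is semisimple. -/
theorem reduction (x : V) (hV : ∀ v : V, ∃ c : F, ∃ v', v = algebraMap F V c + x * v')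
    {n : ℕ} (hn : 2 ≤ n) {t l li m μ : V} {g f : ℕ → Λ} (hr : BRel n t l li m μ g f)
    (hgen : Algebra.adjoin V {x | ∃ i < n, x = g i ∨ x = f i} = ⊤)
    (ht : x ∣ t) (hl : x ∣ l - 1) (hli : x ∣ li - 1) (hm : x ∣ m) (hμ : x ∣ μ)
    (N : Set Λ) (hN : ∀ y ∈ N, ∀ q, IsNilpotent (q * y)) : ∀ y ∈ N, ∃ z, y = x • z := by
  let I : Ideal Λ := Ideal.span {algebraMap V Λ x}
  have hI : I.IsTwoSided := ⟨by
    intro a b ha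
    rw [Ideal.mem_span_singleton'] at ha ⊢
    obtain ⟨c, rfl⟩ := ha
    exact ⟨c * b, by rw [mul_assoc, mul_assoc, Algebra.commutes]⟩⟩
  let π : Λ →ₐ[V] Λ ⧸ I := Ideal.Quotient.mkₐ V I
  have hπ : Function.Surjective π := Ideal.Quotient.mkₐ_surjective V I
  have hx0 : ∀ q : Λ ⧸ I, x • q = 0 := by
    intro q
    obtain ⟨a, rfl⟩ := hπ q
    rw [← map_smul]
    refine Ideal.Quotient.eq_zero_iff_mem.2 ?_
    rw [Ideal.mem_span_singleton']
    exact ⟨a, by rw [← Algebra.commutes, ← Algebra.smul_def]⟩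
  let _ : Algebra F (Λ ⧸ I) := Algebra.compHom _ (algebraMap F V)
  have hFs : ∀ (c : F) (q : Λ ⧸ I), c • q = (algebraMap F V c) • q := fun c q => rfl
  have hdv : ∀ v : V, x ∣ v → ∀ q : Λ ⧸ I, v • q = 0 := by
    rintro _ ⟨v, rfl⟩ q
    rw [mul_smul, hx0]
  have hdv1 : ∀ v : V, x ∣ v - 1 → ∀ q : Λ ⧸ I, v • q = q := by
    intro v hv q
    have := hdv _ hv q
    rw [sub_smul, one_smul, sub_eq_zero] at this
    exact this
  have hr' : BRel n (0 : F) 1 1 0 0 (fun i => π (g i)) (fun i => π (f i)) := by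
    refine hr.map (π : Λ →+* Λ ⧸ I) ?_ ?_ ?_ ?_ ?_ <;> intro y <;>
      simp only [RingHom.coe_coe, map_smul, zero_smul, one_smul]
    · exact hdv _ ht _
    · exact hdv1 _ hl _
    · exact hdv1 _ hli _
    · exact hdv _ hm _
    · exact hdv _ hμ _
  have hss : IsSemisimpleRing (Λ ⧸ I) := by
    refine hr'.semisimple hn ?_
    rw [eq_top_iff]
    rintro q -
    obtain ⟨a, rfl⟩ := hπ q
    have ha : a ∈ Algebra.adjoin V {x | ∃ i < n, x = g i ∨ x = f i} := by rw [hgen]; trivial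
    induction ha using Algebra.adjoin_induction with
    | mem a ha =>
      obtain ⟨i, hi, rfl | rfl⟩ := ha
      · exact Algebra.subset_adjoin ⟨i, hi, Or.inl rfl⟩
      · exact Algebra.subset_adjoin ⟨i, hi, Or.inr rfl⟩
    | algebraMap v =>
      obtain ⟨c, v', rfl⟩ := hV v
      have : π (algebraMap V Λ (algebraMap F V c + x * v')) = algebraMap F (Λ ⧸ I) c := by
        rw [AlgHom.commutes, Algebra.algebraMap_eq_smul_one, add_smul, mul_smul, hx0, add_zero,
          ← hFs, Algebra.algebraMap_eq_smul_one]
      rw [this]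
      exact Subalgebra.algebraMap_mem _ _
    | add a b _ _ iha ihb => rw [map_add]; exact add_mem iha ihb
    | mul a b _ _ iha ihb => rw [map_mul]; exact mul_mem iha ihb
  intro y hy
  have h0 : π y = 0 := by
    apply eq_zero_of_nil
    intro q
    obtain ⟨a, rfl⟩ := hπ q
    rw [← map_mul]
    exact (hN y hy a).map π
  have := Ideal.Quotient.eq_zero_iff_mem.1 h0
  rw [Ideal.mem_span_singleton'] at this
  obtain ⟨z, rfl⟩ := this
  exact ⟨z, by rw [Algebra.smul_def, Algebra.commutes]⟩

end
end BMWProof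

namespace BMWProof
open scoped TensorProduct Pointwise

/-- Pull back the relations along an injective algebra homomorphism. -/
theorem BRel.of_injective {V Λ Λ' : Type*} [CommRing V] [Ring Λ] [Ring Λ'] [Algebra V Λ]
    [Algebra V Λ'] {n : ℕ} {t l li m μ : V} {g f : ℕ → Λ} {g' f' : ℕ → Λ'}
    (hr : BRel n t l li m μ g' f') (φ : Λ →ₐ[V] Λ') (hφ : Function.Injective φ)
    (hg : ∀ i < n, φ (g i) = g' i) (hf : ∀ i < n, φ (f i) = f' i) :
    BRel n t l li m μ g f where
  pair i j hi hj h := by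
    have p := hr.pair i j hi hj h
    rw [← hg i hi, ← hg j hj, ← hf i hi, ← hf j hj] at p
    constructor <;> apply hφ
    · simpa using p.aba
    · simpa using p.abe
    · simpa using p.baf
    · simpa using p.ebe
    · simpa using p.faf
    · simpa using p.ef
    · simpa using p.fe
    · simpa using p.aa
    · simpa using p.ae
    · simpa using p.ea
    · simpa using p.ee
    · simpa using p.bb
    · simpa using p.bf
    · simpa using p.fb
    · simpa using p.ff
  gg i j hi hj h h' := hφ (by simpa [hg i hi, hg j hj] using (hr.gg i j hi hj h h').eq)
  fg i j hi hj h h' := hφ (by simpa [hf i hi, hg j hj] using (hr.fg i j hi hj h h').eq)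
  ff i j hi hj h h' := hφ (by simpa [hf i hi, hf j hj] using (hr.ff i j hi hj h h').eq)
  aa i hi := hφ (by simpa [hg i hi, hf i hi] using hr.aa i hi)
  ae i hi := hφ (by simpa [hg i hi, hf i hi] using hr.ae i hi)
  ea i hi := hφ (by simpa [hg i hi, hf i hi] using hr.ea i hi)
  ee i hi := hφ (by simpa [hg i hi, hf i hi] using hr.ee i hi)

theorem descent {K L F V A : Type*} [Field K] [Field L] [Field F] [CharZero F] [CommRing V]
    [IsDomain V] [IsNoetherianRing V] [Algebra F V] [Algebra K L] [Algebra V L] [IsFractionRing V L]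
    [Ring A] [Algebra K A]
    (x : V) (hx0 : x ≠ 0) (hxJ : x ∈ Ideal.jacobson (⊥ : Ideal V))
    (hV : ∀ v : V, ∃ c : F, ∃ v', v = algebraMap F V c + x * v')
    {n : ℕ} (hn : 2 ≤ n) {t l li m μ : V} {t' l' li' m' μ' : K} {g f : ℕ → A}
    (hr : BRel n t' l' li' m' μ' g f)
    (hgen : Algebra.adjoin K {x | ∃ i < n, x = g i ∨ x = f i} = ⊤)
    (et : algebraMap K L t' = algebraMap V L t) (el : algebraMap K L l' = algebraMap V L l)
    (eli : algebraMap K L li' = algebraMap V L li) (em : algebraMap K L m' = algebraMap V L m)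
    (eμ : algebraMap K L μ' = algebraMap V L μ)
    (ht : x ∣ t) (hl : x ∣ l - 1) (hli : x ∣ li - 1) (hm : x ∣ m) (hμ : x ∣ μ) :
    IsSemisimpleRing A := by
  -- `A` is finite dimensional
  have hfinA : Module.Finite K A := by
    obtain ⟨M, hM, hle⟩ := hr.adjoin_le hn
    rw [hgen] at hle
    have : M = ⊤ := top_le_iff.1 (by simpa using hle)
    exact ⟨this ▸ hM⟩
  have hart : IsArtinianRing A := IsArtinianRing.of_finite K A
  obtain ⟨d, hd⟩ := jac_nilp A
  rw [IsArtinianRing.isSemisimpleRing_iff_jacobson, eq_bot_iff]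
  set J := Ring.jacobson A with hJ
  have hJ2 : ∀ a ∈ J, ∀ b, a * b ∈ J := fun a ha b => J.mul_mem_right b ha
  have : SMulCommClass K V L := ⟨fun a b c => by
    rw [Algebra.smul_def, Algebra.smul_def, Algebra.smul_def, Algebra.smul_def]; ring⟩
  let ι : A →ₐ[K] L ⊗[K] A := Algebra.TensorProduct.includeRight
  have hι : Function.Injective ι :=
    Algebra.TensorProduct.includeRight_injective (algebraMap K L).injective
  have hK : ∀ (c : K) (v : V), algebraMap K L c = algebraMap V L v → ∀ a, ι (c • a) = v • ι a := by
    intro c v hcv a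
    rw [map_smul, ← algebraMap_smul L c, hcv, algebraMap_smul]
  have hr' : BRel n t l li m μ (fun i => ι (g i)) (fun i => ι (f i)) :=
    hr.map (ι : A →+* L ⊗[K] A) (hK _ _ et) (hK _ _ el) (hK _ _ eli) (hK _ _ em) (hK _ _ eμ)
  set S : Set (L ⊗[K] A) := {x | ∃ i < n, x = ι (g i) ∨ x = ι (f i)} with hS
  let Λ : Subalgebra V (L ⊗[K] A) := Algebra.adjoin V S
  have hΛfin : Module.Finite V Λ := by
    obtain ⟨M, hM, hle⟩ := hr'.adjoin_le hn
    have : IsNoetherian V M := isNoetherian_of_fg_of_noetherian M hM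
    have h2 : IsNoetherian V (Subalgebra.toSubmodule Λ) := isNoetherian_of_le hle
    exact Module.IsNoetherian.finite V (Subalgebra.toSubmodule Λ)
  have hgS : ∀ i < n, ι (g i) ∈ Λ := fun i hi => Algebra.subset_adjoin ⟨i, hi, Or.inl rfl⟩
  have hfS : ∀ i < n, ι (f i) ∈ Λ := fun i hi => Algebra.subset_adjoin ⟨i, hi, Or.inr rfl⟩
  let gΛ : ℕ → Λ := fun i => if hi : i < n then ⟨ι (g i), hgS i hi⟩ else 0
  let fΛ : ℕ → Λ := fun i => if hi : i < n then ⟨ι (f i), hfS i hi⟩ else 0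
  have hgΛ : ∀ i < n, Λ.val (gΛ i) = ι (g i) := fun i hi => by simp [gΛ, hi]
  have hfΛ : ∀ i < n, Λ.val (fΛ i) = ι (f i) := fun i hi => by simp [fΛ, hi]
  have hrΛ : BRel n t l li m μ gΛ fΛ := hr'.of_injective Λ.val Subtype.val_injective hgΛ hfΛ
  have hgenΛ : Algebra.adjoin V {x | ∃ i < n, x = gΛ i ∨ x = fΛ i} = ⊤ := by
    rw [eq_top_iff, ← Algebra.adjoin_adjoin_coe_preimage (R := V) (s := S)]
    refine Algebra.adjoin_mono ?_
    rintro y ⟨i, hi, h | h⟩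
    · exact ⟨i, hi, Or.inl (Subtype.ext (h.trans (hgΛ i hi).symm))⟩
    · exact ⟨i, hi, Or.inr (Subtype.ext (h.trans (hfΛ i hi).symm))⟩
  -- the radical
  let s : Set (L ⊗[K] A) := ι '' J
  let JL : Submodule L (L ⊗[K] A) := Submodule.span L s
  have hJLnil : JL ^ (d + 1) = ⊥ := by
    rw [Submodule.span_pow, Submodule.span_eq_bot]
    have : s ^ (d + 1) = ι '' ((J : Set A) ^ (d + 1)) := (Set.image_pow ι _ _).symm
    rw [this]
    rintro _ ⟨a, ha, rfl⟩
    rw [hd a ha, map_zero]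
  have hJLid : ∀ q y, y ∈ JL → q * y ∈ JL := by
    intro q y hy
    induction q with
    | zero => rw [zero_mul]; exact zero_mem _
    | add p q hp hq => rw [add_mul]; exact add_mem hp hq
    | tmul c a =>
      induction hy using Submodule.span_induction with
      | mem y hy =>
        obtain ⟨b, hb, rfl⟩ := hy
        have : (c ⊗ₜ[K] a) * ι b = c • ι (a * b) := by
          simp [ι, TensorProduct.smul_tmul']
        rw [this]
        exact Submodule.smul_mem _ _ (Submodule.subset_span ⟨_, J.mul_mem_left a hb, rfl⟩)
      | zero => rw [mul_zero]; exact zero_mem _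
      | add p q _ _ hp hq => rw [mul_add]; exact add_mem hp hq
      | smul c' p _ hp => rw [mul_smul_comm]; exact Submodule.smul_mem _ _ hp
  -- the intersection with the lattice
  let N : Submodule V Λ := (JL.restrictScalars V).comap Λ.val.toLinearMap
  have hNmem : ∀ y : Λ, y ∈ N ↔ (y : L ⊗[K] A) ∈ JL := fun y => Iff.rfl
  have hN0 : N = ⊥ := by
    refine Submodule.eq_bot_of_le_smul_of_le_jacobson_bot (Ideal.span {x}) N
      (IsNoetherian.noetherian N) ?_ ?_
    · intro y hy
      have hred := reduction (F := F) (Λ := Λ) x hV hn (t := t) (l := l) (li := li) (m := m) (μ := μ)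
        (g := gΛ) (f := fΛ) hrΛ hgenΛ ht hl hli hm hμ N
        (by
          intro y hy q
          refine ⟨d + 1, ?_⟩
          apply Subtype.ext
          have h1 : (q : L ⊗[K] A) * y ∈ JL := hJLid _ _ hy
          have h2 := Submodule.pow_mem_pow JL h1 (d + 1)
          rw [hJLnil] at h2
          simpa using h2) y hy
      obtain ⟨z, rfl⟩ := hred
      refine Submodule.smul_mem_smul (Ideal.mem_span_singleton_self x) ?_
      rw [hNmem] at hy ⊢
      have hxL : algebraMap V L x ≠ 0 := by simpa using hx0
      have : (z : L ⊗[K] A) = (algebraMap V L x)⁻¹ • ((x • z : Λ) : L ⊗[K] A) := by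
        rw [Subalgebra.coe_smul, ← algebraMap_smul L x, smul_smul, inv_mul_cancel₀ hxL, one_smul]
      rw [this]
      exact Submodule.smul_mem _ _ hy
    · rw [Ideal.span_singleton_le_iff_mem]; exact hxJ
  -- clearing denominators
  have hclear : ∀ a : A, ∃ v : V, v ≠ 0 ∧ v • ι a ∈ Λ := by
    intro a
    have ha : a ∈ Algebra.adjoin K {x | ∃ i < n, x = g i ∨ x = f i} := by rw [hgen]; trivial
    induction ha using Algebra.adjoin_induction with
    | mem a ha =>
      refine ⟨1, one_ne_zero, ?_⟩
      rw [one_smul]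
      obtain ⟨i, hi, rfl | rfl⟩ := ha
      · exact hgS i hi
      · exact hfS i hi
    | algebraMap c =>
      obtain ⟨p, q, hq, hpq⟩ := IsFractionRing.div_surjective (A := V) (algebraMap K L c)
      refine ⟨q, nonZeroDivisors.ne_zero hq, ?_⟩
      have hq0 : algebraMap V L q ≠ 0 := by simpa using nonZeroDivisors.ne_zero hq
      have : q • ι (algebraMap K A c) = algebraMap V _ p := by
        rw [Algebra.algebraMap_eq_smul_one, map_smul, map_one, ← algebraMap_smul L c, ← hpq,
          ← algebraMap_smul L q, smul_smul, mul_div_cancel₀ _ hq0, algebraMap_smul,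
          Algebra.algebraMap_eq_smul_one]
      rw [this]
      exact Subalgebra.algebraMap_mem _ _
    | add a b _ _ iha ihb =>
      obtain ⟨v, hv, iha⟩ := iha
      obtain ⟨w, hw, ihb⟩ := ihb
      refine ⟨v * w, mul_ne_zero hv hw, ?_⟩
      rw [map_add, smul_add]
      refine add_mem ?_ ?_
      · rw [mul_comm, mul_smul]; exact Λ.smul_mem iha w
      · rw [mul_smul]; exact Λ.smul_mem ihb v
    | mul a b _ _ iha ihb =>
      obtain ⟨v, hv, iha⟩ := iha
      obtain ⟨w, hw, ihb⟩ := ihb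
      refine ⟨v * w, mul_ne_zero hv hw, ?_⟩
      rw [map_mul, ← smul_mul_smul_comm]
      exact mul_mem iha ihb
  intro j hj
  obtain ⟨v, hv, hvj⟩ := hclear j
  have hvN : (⟨v • ι j, hvj⟩ : Λ) ∈ N := by
    rw [hNmem]
    change v • ι j ∈ JL
    rw [← algebraMap_smul L v]
    exact Submodule.smul_mem _ _ (Submodule.subset_span ⟨j, hj, rfl⟩)
  rw [hN0, Submodule.mem_bot] at hvN
  have h0 : v • ι j = 0 := congrArg Subtype.val hvN
  have hvL : algebraMap V L v ≠ 0 := by simpa using hv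
  rw [← algebraMap_smul L v, smul_eq_zero_iff_right hvL] at h0
  have : j = 0 := hι (by rw [h0, map_zero])
  simpa using this

end BMWProof

noncomputable section
namespace BMWProof
open scoped TensorProduct Polynomial

theorem BMW_rel {n : ℕ} {x y : FreeBMW n} (h : BMWRel n x y) :
    RingQuot.mkAlgHom RBMW (BMWRel n) x = RingQuot.mkAlgHom RBMW (BMWRel n) y :=
  RingQuot.mkAlgHom_rel RBMW h

/-- `δ⁻¹` in `R`. -/
def tR : RBMW := Ideal.Quotient.mk RIdeal (AddMonoidAlgebra.single ((-1 : ℤ), (0 : ℤ), (0 : ℕ)) 1)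

theorem tR_del : tR * delR = 1 := by
  rw [tR, delR, del, ← map_mul, AddMonoidAlgebra.single_mul_single]
  exact map_one _

theorem ell_inv : ellR * ellInvR = 1 := by
  rw [ellR, ellInvR, ell, ellInv, ← map_mul, AddMonoidAlgebra.single_mul_single]
  exact map_one _

theorem m_rel : (1 - delR) * mR = ellR - ellInvR := by
  have : Ideal.Quotient.mk RIdeal ((1 - del) * mvar - ell + ellInv) = 0 :=
    Ideal.Quotient.eq_zero_iff_mem.2 (Ideal.subset_span rfl)
  simp only [map_add, map_sub, map_mul, map_one] at this
  change (1 - delR) * mR - ellR + ellInvR = 0 at this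
  linear_combination this


theorem dAdj_symm {n : ℕ} {i j : Fin n} (h : dAdj i j) : dAdj j i := by
  unfold dAdj at *; tauto

section
variable {V A : Type} [CommRing V] [Ring A] [Algebra V A] {n : ℕ} {t δ l li m : V}
  {g e : Fin n → A}

/-- The BMW relations over an arbitrary base. -/
structure Raw (δ l li m : V) (g e : Fin n → A) : Prop where
  gg : ∀ i j, i ≠ j → ¬ dAdj i j → g i * g j = g j * g i
  eg : ∀ i j, i ≠ j → ¬ dAdj i j → e i * g j = g j * e i
  ee : ∀ i j, i ≠ j → ¬ dAdj i j → e i * e j = e j * e i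
  braid : ∀ i j, dAdj i j → g i * g j * g i = g j * g i * g j
  ege : ∀ i j, dAdj i j → e i * g j * e i = l • e i
  gge : ∀ i j, dAdj i j → g j * g i * e j = e i * e j
  egg : ∀ i j, dAdj i j → e i * g j * g i = e i * e j
  skein : ∀ i, m • e i = l • (g i * g i + m • g i - 1)
  ge : ∀ i, g i * e i = li • e i
  eg' : ∀ i, e i * g i = li • e i
  esq : ∀ i, e i * e i = δ • e i

theorem Raw.sk (h : Raw δ l li m g e) (td : t * δ = 1) (hl : l * li = 1) (i : Fin n) :
    g i * g i = 1 - m • g i + (m * δ * li) • (t • e i) := by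
  have : li • (m • e i) = g i * g i + m • g i - 1 := by
    rw [h.skein, smul_smul, mul_comm, hl, one_smul]
  rw [smul_smul, show m * δ * li * t = li * m * (t * δ) by ring, td, mul_one,
    mul_smul, this]
  abel

theorem Raw.ee0 (h : Raw δ l li m g e) (td : t * δ = 1) (i : Fin n) :
    (t • e i) * (t • e i) = t • e i := by
  rw [smul_mul_smul_comm, h.esq, smul_smul, mul_assoc, td, mul_one]

theorem Raw.pair (h : Raw δ l li m g e) (td : t * δ = 1) (hl : l * li = 1) {i j : Fin n}
    (hij : dAdj i j) : Pair t l li m (m * δ) (g i) (t • e i) (g j) (t • e j) := by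
  have hji := dAdj_symm hij
  refine ⟨h.braid _ _ hij, ?_, ?_, ?_, ?_, ?_, ?_, h.sk td hl i, ?_, ?_, h.ee0 td i,
    h.sk td hl j, ?_, ?_, h.ee0 td j⟩
  · rw [mul_smul_comm, smul_mul_assoc, smul_mul_assoc, h.gge _ _ hji, h.egg _ _ hji]
  · rw [mul_smul_comm, smul_mul_assoc, smul_mul_assoc, h.gge _ _ hij, h.egg _ _ hij]
  · rw [mul_smul_comm, smul_mul_assoc, smul_mul_assoc, h.ege _ _ hij, smul_smul, smul_smul,
      smul_smul, mul_assoc, mul_comm t (t * l)]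
  · rw [mul_smul_comm, smul_mul_assoc, smul_mul_assoc, h.ege _ _ hji, smul_smul, smul_smul,
      smul_smul, mul_assoc, mul_comm t (t * l)]
  · rw [smul_mul_smul_comm, mul_smul_comm, h.gge _ _ hij, smul_smul]
  · rw [smul_mul_smul_comm, mul_smul_comm, h.gge _ _ hji, smul_smul]
  · rw [mul_smul_comm, h.ge, smul_comm]
  · rw [smul_mul_assoc, h.eg', smul_comm]
  · rw [mul_smul_comm, h.ge, smul_comm]
  · rw [smul_mul_assoc, h.eg', smul_comm]

/-- Extension by zero to naturals. -/
def extN (g : Fin n → A) (i : ℕ) : A := if h : i < n then g ⟨i, h⟩ else 0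

theorem extN_val (g : Fin n → A) {i : ℕ} (h : i < n) : extN g i = g ⟨i, h⟩ := by
  simp [extN, h]

theorem Raw.bRel (h : Raw δ l li m g e) (td : t * δ = 1) (hl : l * li = 1) :
    BRel n t l li m (m * δ) (extN g) (extN fun i => t • e i) := by
  constructor
  · intro i j hi hj hij
    simp only [extN_val _ hi, extN_val _ hj]
    exact h.pair td hl hij
  · intro i j hi hj hij ha
    simp only [extN_val _ hi, extN_val _ hj]
    exact h.gg _ _ (by simpa using hij) ha
  · intro i j hi hj hij ha
    simp only [extN_val _ hi, extN_val _ hj]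
    exact Commute.smul_left (h.eg ⟨i, hi⟩ ⟨j, hj⟩ (by simpa using hij) ha) _
  · intro i j hi hj hij ha
    simp only [extN_val _ hi, extN_val _ hj]
    exact Commute.smul_left (Commute.smul_right (h.ee ⟨i, hi⟩ ⟨j, hj⟩ (by simpa using hij) ha) _) _
  · intro i hi
    simp only [extN_val _ hi]
    exact h.sk td hl _
  · intro i hi
    simp only [extN_val _ hi]
    rw [mul_smul_comm, h.ge, smul_comm]
  · intro i hi
    simp only [extN_val _ hi]
    rw [smul_mul_assoc, h.eg', smul_comm]
  · intro i hi
    simp only [extN_val _ hi]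
    exact h.ee0 td _
end

section
variable (n : ℕ) (K : Type) [Field K] [Algebra RBMW K]

/-- The map from the free algebra. -/
def qA : FreeBMW n →ₐ[RBMW] K ⊗[RBMW] BMW n :=
  (Algebra.TensorProduct.includeRight : BMW n →ₐ[RBMW] K ⊗[RBMW] BMW n).comp
    (RingQuot.mkAlgHom RBMW (BMWRel n))

theorem qA_rel {x y : FreeBMW n} (h : BMWRel n x y) : qA n K x = qA n K y := by
  simp only [qA, AlgHom.comp_apply, BMW_rel h]

theorem qA_smul (r : RBMW) (x : FreeBMW n) : qA n K (r • x) = algebraMap RBMW K r • qA n K x := by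
  rw [map_smul]
  exact (algebraMap_smul K r _).symm

theorem raw_A : Raw (algebraMap RBMW K delR) (algebraMap RBMW K ellR) (algebraMap RBMW K ellInvR)
    (algebraMap RBMW K mR) (fun i => qA n K (gF i)) (fun i => qA n K (eF i)) := by
  refine ⟨fun i j h h' => ?_, fun i j h h' => ?_, fun i j h h' => ?_, fun i j h => ?_,
    fun i j h => ?_, fun i j h => ?_, fun i j h => ?_, fun i => ?_, fun i => ?_, fun i => ?_,
    fun i => ?_⟩
  · simpa only [map_mul] using qA_rel n K (.gg h h')
  · simpa only [map_mul] using qA_rel n K (.eg h h')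
  · simpa only [map_mul] using qA_rel n K (.ee h h')
  · simpa only [map_mul] using qA_rel n K (.braid h)
  · simpa only [map_mul, qA_smul] using qA_rel n K (.ege h)
  · simpa only [map_mul] using qA_rel n K (.gge h)
  · simpa only [map_mul] using qA_rel n K (.egg h)
  · simpa only [map_mul, map_add, map_sub, map_one, qA_smul] using qA_rel n K (.skein (i := i))
  · simpa only [map_mul, qA_smul] using qA_rel n K (.ge (i := i))
  · simpa only [map_mul, qA_smul] using qA_rel n K (.eg' (i := i))
  · simpa only [map_mul, qA_smul] using qA_rel n K (.esq (i := i))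

theorem tdK : algebraMap RBMW K tR * algebraMap RBMW K delR = 1 := by
  rw [← map_mul, tR_del, map_one]

theorem liK : algebraMap RBMW K ellR * algebraMap RBMW K ellInvR = 1 := by
  rw [← map_mul, ell_inv, map_one]

theorem bRel_A : BRel n (algebraMap RBMW K tR) (algebraMap RBMW K ellR)
    (algebraMap RBMW K ellInvR) (algebraMap RBMW K mR)
    (algebraMap RBMW K mR * algebraMap RBMW K delR) (extN fun i => qA n K (gF i))
    (extN fun i => algebraMap RBMW K tR • qA n K (eF i)) :=
  (raw_A n K).bRel (tdK K) (liK K)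

theorem gen_A : Algebra.adjoin K {x | ∃ i < n, x = extN (fun i => qA n K (gF i)) i ∨
    x = extN (fun i => algebraMap RBMW K tR • qA n K (eF i)) i} = ⊤ := by
  set S := Algebra.adjoin K {x | ∃ i < n, x = extN (fun i => qA n K (gF i)) i ∨
    x = extN (fun i => algebraMap RBMW K tR • qA n K (eF i)) i} with hS
  have hq : ∀ x, qA n K x ∈ S := by
    intro x
    induction x using FreeAlgebra.induction with
    | grade0 r =>
      rw [AlgHom.commutes, IsScalarTower.algebraMap_apply RBMW K]
      exact S.algebraMap_mem _
    | grade1 x =>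
      rcases x with i | i
      · refine Algebra.subset_adjoin ⟨i, i.2, Or.inl ?_⟩
        rw [extN_val _ i.2]; rfl
      · have h : algebraMap RBMW K tR • qA n K (eF i) ∈ S := by
          refine Algebra.subset_adjoin ⟨i, i.2, Or.inr ?_⟩
          rw [extN_val _ i.2]
        have h2 := S.smul_mem h (algebraMap RBMW K delR)
        rwa [smul_smul, mul_comm, tdK, one_smul] at h2
    | mul a b ha hb => rw [map_mul]; exact S.mul_mem ha hb
    | add a b ha hb => rw [map_add]; exact S.add_mem ha hb
  rw [eq_top_iff]
  rintro x -
  induction x using TensorProduct.induction_on with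
  | zero => exact S.zero_mem
  | add a b ha hb => exact S.add_mem ha hb
  | tmul k b =>
    obtain ⟨x, rfl⟩ := RingQuot.mkAlgHom_surjective RBMW (BMWRel n) b
    have := S.smul_mem (hq x) k
    simpa [qA, TensorProduct.smul_tmul'] using this
end
end BMWProof
end

noncomputable section
namespace BMWProof
open scoped Polynomial PowerSeries

/-- Residue field. -/
abbrev FF : Type := RatFunc ℚ
/-- Power series ring. -/
abbrev VV : Type := PowerSeries FF
/-- Its fraction field. -/
abbrev LL : Type := FractionRing VV

theorem VV_jac : (PowerSeries.X : VV) ∈ Ideal.jacobson (⊥ : Ideal VV) := by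
  rw [Ideal.mem_jacobson_bot]
  intro y
  rw [PowerSeries.isUnit_iff_constantCoeff]
  simp

theorem VV_dec (v : VV) : ∃ c : FF, ∃ v', v = algebraMap FF VV c + PowerSeries.X * v' := by
  have h : (PowerSeries.X : VV) ∣ v - PowerSeries.C (PowerSeries.constantCoeff v) := by
    rw [PowerSeries.X_dvd_iff]; simp
  obtain ⟨w, hw⟩ := h
  exact ⟨PowerSeries.constantCoeff v, w, by rw [← hw]; simp [PowerSeries.algebraMap_eq]⟩

/-- The parameter `t`. -/
def tV : VV := PowerSeries.C RatFunc.X * PowerSeries.X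
/-- The parameter `l`. -/
def lV : VV := 1 + PowerSeries.X

theorem lV_unit : IsUnit lV := by
  rw [PowerSeries.isUnit_iff_constantCoeff]; simp [lV]

theorem tV_unit : IsUnit (tV - 1) := by
  rw [PowerSeries.isUnit_iff_constantCoeff]; simp [tV]

/-- Inverse of `l`. -/
def liV : VV := ↑(lV_unit.unit⁻¹)
/-- Inverse of `t - 1`. -/
def wV : VV := ↑(tV_unit.unit⁻¹)
theorem lV_li : lV * liV = 1 := lV_unit.mul_val_inv
theorem tV_w : (tV - 1) * wV = 1 := tV_unit.mul_val_inv
/-- The parameter `μ`. -/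
def μV : VV := (lV - liV) * wV
/-- The parameter `m`. -/
def mV : VV := tV * μV

theorem l_dvd : (PowerSeries.X : VV) ∣ lV - 1 := ⟨1, by simp [lV]⟩
theorem t_dvd : (PowerSeries.X : VV) ∣ tV := Dvd.intro_left _ rfl
theorem li_dvd : (PowerSeries.X : VV) ∣ liV - 1 := by
  have : liV - 1 = -(lV - 1) * liV := by linear_combination lV_li
  rw [this]
  exact Dvd.dvd.mul_right ((dvd_neg).2 l_dvd) _
theorem μ_dvd : (PowerSeries.X : VV) ∣ μV := by
  refine Dvd.dvd.mul_right ?_ _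
  have := dvd_sub l_dvd li_dvd
  simpa using this
theorem m_dvd : (PowerSeries.X : VV) ∣ mV := t_dvd.mul_right _

/-- The embedding of bivariate integer polynomials into `V`. -/
def Ψ : ℤ[X][X] →+* VV :=
  (Polynomial.coeToPowerSeries.ringHom (R := FF)).comp <|
  (Polynomial.mapRingHom (Polynomial.eval₂RingHom (Int.castRingHom FF) RatFunc.X)).comp <|
  (Polynomial.Bivariate.swap (R := ℤ) : ℤ[X][X] →+* ℤ[X][X]).comp <|
  Polynomial.compRingHom (Polynomial.C Polynomial.X * Polynomial.X)

theorem Ψ_inj : Function.Injective Ψ := by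
  have h1 : Function.Injective (Polynomial.coeToPowerSeries.ringHom (R := FF)) :=
    Polynomial.coe_injective FF
  have h2 : Function.Injective (Polynomial.mapRingHom
      (Polynomial.eval₂RingHom (Int.castRingHom FF) RatFunc.X)) := by
    refine Polynomial.map_injective _ ?_
    have : (Polynomial.eval₂RingHom (Int.castRingHom FF) RatFunc.X) =
        (algebraMap ℚ[X] FF).comp (Polynomial.mapRingHom (Int.castRingHom ℚ)) := by
      ext <;> simp
    rw [this]
    exact (IsFractionRing.injective ℚ[X] FF).comp
      (Polynomial.map_injective _ (RingHom.injective_int _))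
  have h3 : Function.Injective (Polynomial.Bivariate.swap (R := ℤ) : ℤ[X][X] →+* ℤ[X][X]) :=
    (Polynomial.Bivariate.swap (R := ℤ)).injective
  have h4 : Function.Injective (Polynomial.compRingHom
      (Polynomial.C Polynomial.X * Polynomial.X : ℤ[X][X])) := by
    rw [injective_iff_map_eq_zero]
    intro p hp
    ext1 k
    have := congrArg (fun q => Polynomial.coeff q k) hp
    simp only [Polynomial.coe_compRingHom, Polynomial.comp_C_mul_X_coeff, Polynomial.coeff_zero] at this
    simpa using this
  exact h1.comp (h2.comp (h3.comp h4))

theorem Ψ_CX : Ψ (Polynomial.C Polynomial.X) = PowerSeries.X := by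
  simp [Ψ, Polynomial.Bivariate.swap_X, Polynomial.Bivariate.swap_Y]
theorem Ψ_X : Ψ Polynomial.X = tV := by
  simp [Ψ, tV, Polynomial.Bivariate.swap_X, Polynomial.Bivariate.swap_Y]

/-- The scalar `δ` etc. in `L`. -/
def tL : LLˣ := Units.mk0 (algebraMap VV LL tV) (by
  rw [Ne, FaithfulSMul.algebraMap_eq_zero_iff]
  simp [tV, RatFunc.X_ne_zero])
/-- `l` as a unit of `L`. -/
def lL : LLˣ := lV_unit.unit.map (algebraMap VV LL : VV →* LL)

/-- Monomials in `L`. -/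
def monL : Multiplicative (ℤ × ℤ × ℕ) →* LL where
  toFun p := ((tL⁻¹ ^ p.toAdd.1 * lL ^ p.toAdd.2.1 : LLˣ) : LL) *
    (algebraMap VV LL mV) ^ p.toAdd.2.2
  map_one' := by simp
  map_mul' p q := by
    simp only [toAdd_mul, Prod.fst_add, Prod.snd_add, zpow_add, pow_add, Units.val_mul]
    ring

/-- The map from `PreR`. -/
def preφ : PreR →+* LL := AddMonoidAlgebra.lift ℤ LL (ℤ × ℤ × ℕ) monL

theorem preφ_single (p) : preφ (AddMonoidAlgebra.single p 1) = monL (.ofAdd p) := by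
  simp only [preφ, RingHom.coe_coe, AddMonoidAlgebra.lift_single]
  rw [Algebra.smul_def, map_one, one_mul]


theorem tL_del : preφ del * algebraMap VV LL tV = 1 := by
  have h0 : algebraMap VV LL tV ≠ 0 := tL.ne_zero
  rw [del, preφ_single]
  simp [monL, tL, inv_mul_cancel₀ h0]
theorem preφ_t : preφ (AddMonoidAlgebra.single ((-1 : ℤ), (0 : ℤ), (0 : ℕ)) 1)
    = algebraMap VV LL tV := by
  rw [preφ_single]
  simp [monL, tL]
theorem preφ_l : preφ ell = algebraMap VV LL lV := by
  rw [ell, preφ_single]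
  simp [monL, lL]
theorem preφ_li : preφ ellInv = algebraMap VV LL liV := by
  rw [ellInv, preφ_single]
  have h : algebraMap VV LL lV * algebraMap VV LL liV = 1 := by
    rw [← map_mul, lV_li, map_one]
  simp only [monL, lL, MonoidHom.coe_mk, OneHom.coe_mk, toAdd_ofAdd, zpow_zero, one_mul,
    pow_zero, mul_one, zpow_neg, zpow_one]
  rw [Units.inv_eq_of_mul_eq_one_right]
  simpa using h
theorem preφ_m : preφ mvar = algebraMap VV LL mV := by
  rw [mvar, preφ_single]
  simp [monL]

theorem preφ_rel : preφ ((1 - del) * mvar - ell + ellInv) = 0 := by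
  simp only [map_add, map_sub, map_mul, map_one, preφ_l, preφ_li, preφ_m]
  have h := tL_del
  have hw : (algebraMap VV LL tV - 1) * algebraMap VV LL wV = 1 := by
    rw [← map_one (algebraMap VV LL), ← map_sub, ← map_mul, tV_w]
  simp only [mV, μV, map_mul, map_sub]
  linear_combination (algebraMap VV LL lV - algebraMap VV LL liV) * hw -
    (algebraMap VV LL lV - algebraMap VV LL liV) * algebraMap VV LL wV * h

/-- The map from `R`. -/
def φR : RBMW →+* LL := Ideal.Quotient.lift RIdeal preφ (by
  intro a ha
  have : RIdeal ≤ RingHom.ker preφ := by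
    rw [RIdeal, Ideal.span_le]
    rintro _ rfl
    exact preφ_rel
  exact this ha)

theorem φR_t : φR tR = algebraMap VV LL tV := preφ_t
theorem φR_l : φR ellR = algebraMap VV LL lV := preφ_l
theorem φR_li : φR ellInvR = algebraMap VV LL liV := preφ_li
theorem φR_m : φR mR = algebraMap VV LL mV := preφ_m
theorem φR_d : φR delR * algebraMap VV LL tV = 1 := tL_del
theorem φR_μ : φR (mR * delR) = algebraMap VV LL μV := by
  rw [map_mul, φR_m, mV, map_mul]
  linear_combination algebraMap VV LL μV * φR_d

/-- Evaluation of bivariate polynomials in `R`. -/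
def evR : ℤ[X][X] →+* RBMW :=
  Polynomial.eval₂RingHom (Polynomial.eval₂RingHom (Int.castRingHom RBMW) (ellR - 1)) tR

theorem evR_X : evR Polynomial.X = tR := by simp [evR]
theorem evR_CX : evR (Polynomial.C Polynomial.X) = ellR - 1 := by simp [evR]

theorem φR_ev (P : ℤ[X][X]) : φR (evR P) = algebraMap VV LL (Ψ P) := by
  have : φR.comp evR = (algebraMap VV LL).comp Ψ := by
    ext
    · simp
    · simp only [RingHom.comp_apply, evR_CX, Ψ_CX, map_sub, map_one, φR_l, lV, map_add]
      ring
    · simp only [RingHom.comp_apply, evR_X, Ψ_X, φR_t]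
  exact congrArg (fun f => f P) this

/-- The denominator. -/
def DR : RBMW := ellR * tR * (tR - 1)

/-- Elements whose denominators can be cleared. -/
def TR : Subring RBMW where
  carrier := {x | ∃ N : ℕ, ∃ P, DR ^ N * x = evR P}
  zero_mem' := ⟨0, 0, by simp⟩
  one_mem' := ⟨0, 1, by simp⟩
  neg_mem' := by
    rintro x ⟨N, P, h⟩
    exact ⟨N, -P, by rw [map_neg, ← h]; ring⟩
  add_mem' := by
    rintro x y ⟨N, P, h⟩ ⟨M, Q, h'⟩
    obtain ⟨D, hD⟩ : ∃ D, evR D = DR := ⟨(Polynomial.C Polynomial.X + 1) * Polynomial.X *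
      (Polynomial.X - 1), by simp [evR_X, evR_CX, DR]⟩
    refine ⟨N + M, D ^ M * P + D ^ N * Q, ?_⟩
    simp only [map_add, map_mul, map_pow, ← h, ← h', hD]
    ring
  mul_mem' := by
    rintro x y ⟨N, P, h⟩ ⟨M, Q, h'⟩
    refine ⟨N + M, P * Q, ?_⟩
    simp only [map_mul, ← h, ← h']
    ring

theorem TR_t : tR ∈ TR := ⟨0, Polynomial.X, by simp [evR_X]⟩
theorem TR_l : ellR ∈ TR := ⟨0, Polynomial.C Polynomial.X + 1, by simp [evR_CX]⟩
theorem TR_li : ellInvR ∈ TR := by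
  refine ⟨1, Polynomial.X * (Polynomial.X - 1), ?_⟩
  simp only [map_mul, map_sub, map_one, evR_X, pow_one, DR]
  linear_combination tR * (tR - 1) * ell_inv
theorem TR_d : delR ∈ TR := by
  refine ⟨1, (Polynomial.C Polynomial.X + 1) * (Polynomial.X - 1), ?_⟩
  simp only [map_mul, map_sub, map_add, map_one, evR_X, evR_CX, pow_one, DR]
  linear_combination ellR * (tR - 1) * tR_del
theorem TR_m : mR ∈ TR := by
  refine ⟨1, Polynomial.X ^ 2 * ((Polynomial.C Polynomial.X + 1) ^ 2 - 1), ?_⟩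
  simp only [map_mul, map_sub, map_add, map_one, map_pow, evR_X, evR_CX, pow_one, DR]
  linear_combination ellR * tR ^ 2 * m_rel + tR ^ 2 * (-1) * ell_inv + ellR * tR * mR * tR_del

theorem single_eq (a b : ℤ) (c : ℕ) : Ideal.Quotient.mk RIdeal
    (AddMonoidAlgebra.single (a, b, c) 1) ∈ TR := by
  have hmul : ∀ p q : ℤ × ℤ × ℕ, (AddMonoidAlgebra.single (p + q) (1 : ℤ) : PreR) =
      AddMonoidAlgebra.single p 1 * AddMonoidAlgebra.single q 1 := by
    intro p q; rw [AddMonoidAlgebra.single_mul_single, one_mul]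
  have hpow : ∀ (p : ℤ × ℤ × ℕ) (k : ℕ), (AddMonoidAlgebra.single (k • p) (1 : ℤ) : PreR) =
      (AddMonoidAlgebra.single p 1) ^ k := by
    intro p k; rw [AddMonoidAlgebra.single_pow, one_pow]
  have h1 : Ideal.Quotient.mk RIdeal (AddMonoidAlgebra.single (a, 0, 0) 1) ∈ TR := by
    obtain ⟨k, rfl | rfl⟩ := Int.eq_nat_or_neg a
    · have := hpow (1, 0, 0) k
      simp only [Prod.smul_mk, smul_zero, nsmul_eq_mul, mul_one] at this
      rw [this, map_pow]
      exact TR.pow_mem TR_d k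
    · have := hpow (-1, 0, 0) k
      simp only [Prod.smul_mk, smul_zero, nsmul_eq_mul, mul_neg, mul_one] at this
      rw [this, map_pow]
      exact TR.pow_mem TR_t k
  have h2 : Ideal.Quotient.mk RIdeal (AddMonoidAlgebra.single (0, b, 0) 1) ∈ TR := by
    obtain ⟨k, rfl | rfl⟩ := Int.eq_nat_or_neg b
    · have := hpow (0, 1, 0) k
      simp only [Prod.smul_mk, smul_zero, nsmul_eq_mul, mul_one] at this
      rw [this, map_pow]
      exact TR.pow_mem TR_l k
    · have := hpow (0, -1, 0) k
      simp only [Prod.smul_mk, smul_zero, nsmul_eq_mul, mul_neg, mul_one] at this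
      rw [this, map_pow]
      exact TR.pow_mem TR_li k
  have h3 : Ideal.Quotient.mk RIdeal (AddMonoidAlgebra.single (0, 0, c) 1) ∈ TR := by
    have := hpow (0, 0, 1) c
    simp only [Prod.smul_mk, smul_zero, nsmul_eq_mul, mul_one, Nat.cast_id] at this
    rw [this, map_pow]
    exact TR.pow_mem TR_m c
  have : (a, b, c) = ((a, 0, 0) : ℤ × ℤ × ℕ) + ((0, b, 0) + (0, 0, c)) := by simp
  rw [this, hmul, hmul, map_mul, map_mul]
  exact TR.mul_mem h1 (TR.mul_mem h2 h3)

theorem TR_top (x : RBMW) : x ∈ TR := by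
  obtain ⟨y, rfl⟩ := Ideal.Quotient.mk_surjective x
  induction y using AddMonoidAlgebra.induction_linear with
  | zero => rw [map_zero]; exact TR.zero_mem
  | add a b ha hb => rw [map_add]; exact TR.add_mem ha hb
  | single p c =>
    obtain ⟨a, b, k⟩ := p
    have : (AddMonoidAlgebra.single (a, b, k) c : PreR) =
        c • AddMonoidAlgebra.single (a, b, k) 1 := by
      simp
    rw [this, map_zsmul]
    exact TR.zsmul_mem (single_eq a b k) c

theorem φR_inj [IsDomain RBMW] : Function.Injective φR := by
  rw [injective_iff_map_eq_zero]
  intro x hx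
  obtain ⟨N, P, h⟩ := TR_top x
  have hP : P = 0 := by
    apply Ψ_inj
    apply IsFractionRing.injective VV LL
    rw [← φR_ev, ← h, map_mul, hx, mul_zero, map_zero, map_zero]
  rw [hP, map_zero] at h
  have hD : DR ≠ 0 := by
    intro h0
    have h1 : (Polynomial.C Polynomial.X + 1) * Polynomial.X * (Polynomial.X - 1) = (0 : ℤ[X][X]) := by
      apply Ψ_inj
      apply IsFractionRing.injective VV LL
      rw [← φR_ev]
      have : evR ((Polynomial.C Polynomial.X + 1) * Polynomial.X * (Polynomial.X - 1)) = DR := by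
        simp [evR_X, evR_CX, DR]
      rw [this, h0, map_zero, map_zero, map_zero]
    have h2 := congrArg (fun p => (p.eval 2).eval 1) h1
    norm_num at h2
  exact (mul_eq_zero.1 h).resolve_left (pow_ne_zero _ hD)

open scoped TensorProduct in
theorem bmw_final (n : ℕ) (hn : 2 ≤ n) (K : Type) [Field K] [Algebra RBMW K]
    [IsFractionRing RBMW K] : IsSemisimpleRing (K ⊗[RBMW] BMW n) := by
  have : IsDomain RBMW := (IsFractionRing.injective RBMW K).isDomain (algebraMap RBMW K)
  let _ : Algebra K LL := (IsFractionRing.lift (A := RBMW) (K := K) φR_inj).toAlgebra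
  have hK : ∀ r, algebraMap K LL (algebraMap RBMW K r) = φR r := fun r =>
    IsFractionRing.lift_algebraMap φR_inj r
  exact descent (L := LL) (F := FF) (V := VV) PowerSeries.X PowerSeries.X_ne_zero VV_jac VV_dec hn
    (bRel_A n K) (gen_A n K) ((hK _).trans φR_t) ((hK _).trans φR_l) ((hK _).trans φR_li)
    ((hK _).trans φR_m) (by rw [← map_mul]; exact (hK _).trans φR_μ)
    t_dvd l_dvd li_dvd m_dvd μ_dvd

end BMWProof
end

open scoped TensorProduct in
/-- For `n ≥ 2` the algebra `B(D_n) ⊗_R K` obtained by extending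
scalars from `R` to its field of fractions `K = Frac(R) ≅ ℚ(l, δ)` is a semisimple
ring.  (`K` is any realisation of the fraction field of `R`, expressed by
`[Field K] [Algebra RBMW K] [IsFractionRing RBMW K]`.) -/
theorem bmw_tensor_fractionField_semisimple (n : ℕ) (hn : 2 ≤ n)
    (K : Type) [Field K] [Algebra RBMW K] [IsFractionRing RBMW K] :
    IsSemisimpleRing (K ⊗[RBMW] BMW n) := by
  exact BMWProof.bmw_final n hn K
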